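/- arXiv:2007.02143 — 11 statements merged into one kernel-verified Lean document; each statement's English description precedes it below -/
import Mathlib

section
/- Let s₀ be a complex eigenvalue of the companion matrix 𝒞 whose algebraic multiplicity (its multiplicity as a root of the characteristic polynomial of 𝒞 regarded over ℂ) is at least 2. Then: (i) s₀ ≠ 0; (ii) −s₀ is also an eigenvalue of 𝒞; (iii) s₀ is either real or purely imaginary (i.e. Re s₀ = 0 or Im s₀ = 0); (iv) the algebraic multiplicities of s₀ and of −s₀ are both exactly 2. -/
open Polynomial Matrix

theorem aux_charpoly (x y u v : ℝ) :
    (!![0, 0, 1, 0; 0, 0, 0, 1; -x, 0, 0, u; 0, -y, -v, 0] : Matrix (Fin 4) (Fin 4) ℝ).charpoly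
      = X ^ 4 + C (x + y + u * v) * X ^ 2 + C (x * y) := by
  rw [Matrix.charpoly, Matrix.det_succ_row_zero]
  simp [Fin.sum_univ_succ, Matrix.det_fin_three, Matrix.charmatrix_apply, Fin.succAbove,
    Matrix.submatrix_apply, Matrix.diagonal_apply]
  try ring

theorem aux_mult (s : ℂ) (hs : s ≠ 0) :
    rootMultiplicity s ((X - C s) ^ 2 * (X - C (-s)) ^ 2) = 2 := by
  have h0 : ((X - C s) ^ 2 * (X - C (-s)) ^ 2 : ℂ[X]) ≠ 0 :=
    mul_ne_zero (pow_ne_zero _ (X_sub_C_ne_zero _)) (pow_ne_zero _ (X_sub_C_ne_zero _))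
  rw [rootMultiplicity_mul h0, rootMultiplicity_X_sub_C_pow, rootMultiplicity_eq_zero]
  have h2 : s + s ≠ 0 := by
    intro h
    apply hs
    linear_combination h / 2
  simp [IsRoot, h2]

theorem aux_main (b c : ℝ) (hc : c ≠ 0) (p : ℝ[X]) (hp : p = X ^ 4 + C b * X ^ 2 + C c) (s : ℂ)
    (hroot : (p.map (algebraMap ℝ ℂ)).IsRoot s)
    (hmult : 2 ≤ rootMultiplicity s (p.map (algebraMap ℝ ℂ))) :
    s ≠ 0 ∧ (p.map (algebraMap ℝ ℂ)).IsRoot (-s) ∧ (s.re = 0 ∨ s.im = 0) ∧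
    rootMultiplicity s (p.map (algebraMap ℝ ℂ)) = 2 ∧
    rootMultiplicity (-s) (p.map (algebraMap ℝ ℂ)) = 2 := by
  have hq : p.map (algebraMap ℝ ℂ) = X ^ 4 + C (b : ℂ) * X ^ 2 + C (c : ℂ) := by
    simp [hp]
  rw [hq] at hroot hmult ⊢
  have hne : (X ^ 4 + C (b : ℂ) * X ^ 2 + C (c : ℂ) : ℂ[X]) ≠ 0 := by
    intro h
    rw [h] at hmult
    simp at hmult
  have hd := ((one_lt_rootMultiplicity_iff_isRoot hne).1 hmult).2
  have hcC : (c : ℂ) ≠ 0 := by exact_mod_cast hc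
  simp [IsRoot] at hroot hd
  have hs : s ≠ 0 := by
    rintro rfl
    simp at hroot
    exact hc hroot
  have hb : (b : ℂ) = -2 * s ^ 2 := by
    apply mul_left_cancel₀ (mul_ne_zero two_ne_zero hs)
    linear_combination hd
  have hc' : (c : ℂ) = s ^ 4 := by
    rw [hb] at hroot
    linear_combination hroot
  have hf : (X ^ 4 + C (b : ℂ) * X ^ 2 + C (c : ℂ) : ℂ[X])
      = (X - C s) ^ 2 * (X - C (-s)) ^ 2 := by
    rw [hb, hc']
    simp
    rw [show (C (2 : ℂ) : ℂ[X]) = 2 from rfl]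
    ring
  have him : s.re = 0 ∨ s.im = 0 := by
    have := congrArg Complex.im hb
    simp [pow_two] at this
    rcases eq_or_ne s.re 0 with h | h
    · exact Or.inl h
    · right
      apply mul_left_cancel₀ h
      linarith
  rw [hf]
  refine ⟨hs, ?_, him, aux_mult s hs, ?_⟩
  · simp [IsRoot]
  · have := aux_mult (-s) (neg_ne_zero.2 hs)
    rw [neg_neg, mul_comm] at this
    exact this

/-- If s₀ is a complex eigenvalue of the companion matrix 𝒞 whose
algebraic multiplicity is at least 2, then (i) s₀ ≠ 0; (ii) −s₀ is also an
eigenvalue; (iii) s₀ is real or purely imaginary; (iv) the algebraic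
multiplicities of s₀ and −s₀ are both exactly 2. -/
theorem degenerate_eigenvalue_properties
    (L₁ C₁ L₂ C₂ G₁ : ℝ) (hL₁ : L₁ ≠ 0) (hC₁ : C₁ ≠ 0) (hL₂ : L₂ ≠ 0)
    (hC₂ : C₂ ≠ 0) (hG₁ : G₁ ≠ 0) (s₀ : ℂ)
    (hroot :
      (((!![0, 0, 1, 0;
            0, 0, 0, 1;
            -(1/(L₁*C₁)), 0, 0, G₁/L₁;
            0, -(1/(L₂*C₂)), -(G₁/L₂), 0] : Matrix (Fin 4) (Fin 4) ℝ).charpoly).map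
          (algebraMap ℝ ℂ)).IsRoot s₀)
    (hmult :
      2 ≤ Polynomial.rootMultiplicity s₀
        (((!![0, 0, 1, 0;
              0, 0, 0, 1;
              -(1/(L₁*C₁)), 0, 0, G₁/L₁;
              0, -(1/(L₂*C₂)), -(G₁/L₂), 0] : Matrix (Fin 4) (Fin 4) ℝ).charpoly).map
            (algebraMap ℝ ℂ))) :
    s₀ ≠ 0 ∧
    (((!![0, 0, 1, 0;
          0, 0, 0, 1;
          -(1/(L₁*C₁)), 0, 0, G₁/L₁;
          0, -(1/(L₂*C₂)), -(G₁/L₂), 0] : Matrix (Fin 4) (Fin 4) ℝ).charpoly).map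
        (algebraMap ℝ ℂ)).IsRoot (-s₀) ∧
    (s₀.re = 0 ∨ s₀.im = 0) ∧
    Polynomial.rootMultiplicity s₀
      (((!![0, 0, 1, 0;
            0, 0, 0, 1;
            -(1/(L₁*C₁)), 0, 0, G₁/L₁;
            0, -(1/(L₂*C₂)), -(G₁/L₂), 0] : Matrix (Fin 4) (Fin 4) ℝ).charpoly).map
          (algebraMap ℝ ℂ)) = 2 ∧
    Polynomial.rootMultiplicity (-s₀)
      (((!![0, 0, 1, 0;
            0, 0, 0, 1;
            -(1/(L₁*C₁)), 0, 0, G₁/L₁;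
            0, -(1/(L₂*C₂)), -(G₁/L₂), 0] : Matrix (Fin 4) (Fin 4) ℝ).charpoly).map
          (algebraMap ℝ ℂ)) = 2 := by
  exact aux_main _ _ (by positivity) _ (aux_charpoly _ _ _ _) s₀ hroot hmult
end

section
/- The companion matrix 𝒞 has a degenerate eigenvalue (i.e. its characteristic polynomial, regarded over ℂ, has some root of multiplicity at least 2) if and only if the following hold: ξ₁·ξ₂ > 0, ξ₁·(L₁L₂) < 0, and there exists δ ∈ {1, −1} with G₁² = (√|ξ₁| + δ·√|ξ₂|)²·|L₁L₂|. -/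
open Polynomial Matrix

lemma charpoly_aux (a b c d : ℝ) :
    (!![0, 0, 1, 0;
        0, 0, 0, 1;
        -a, 0, 0, c;
        0, -b, -d, 0] : Matrix (Fin 4) (Fin 4) ℝ).charpoly
      = X ^ 4 + C (a + b + c * d) * X ^ 2 + C (a * b) := by
  simp [Matrix.charpoly, Matrix.charmatrix, Matrix.det_succ_row_zero, Fin.sum_univ_succ,
    Fin.succAbove, Matrix.submatrix, Matrix.diagonal]
  ring

lemma double_root_aux (a b : ℝ) (hb : b ≠ 0) :
    (∃ s₀ : ℂ, 2 ≤ Polynomial.rootMultiplicity s₀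
      ((X ^ 4 + C a * X ^ 2 + C b : ℝ[X]).map (algebraMap ℝ ℂ))) ↔ a ^ 2 = 4 * b := by
  have hne : ((X ^ 4 + C a * X ^ 2 + C b : ℝ[X]).map (algebraMap ℝ ℂ)) ≠ 0 := by
    intro h
    have h2 := congrArg (Polynomial.eval 0) h
    simp at h2
    exact hb h2
  have key : ∀ s : ℂ, 2 ≤ Polynomial.rootMultiplicity s
      ((X ^ 4 + C a * X ^ 2 + C b : ℝ[X]).map (algebraMap ℝ ℂ)) ↔
      (s ^ 4 + a * s ^ 2 + b = 0 ∧ 4 * s ^ 3 + a * (2 * s) = 0) := by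
    intro s
    have h := Polynomial.one_lt_rootMultiplicity_iff_isRoot (t := s) hne
    rw [show (2 ≤ Polynomial.rootMultiplicity s
      ((X ^ 4 + C a * X ^ 2 + C b : ℝ[X]).map (algebraMap ℝ ℂ))) ↔ _ from h]
    simp [Polynomial.IsRoot]
    intro _
    norm_num
  simp only [key]
  have hbC : (b : ℂ) ≠ 0 := by exact_mod_cast hb
  constructor
  · rintro ⟨s, h1, h2⟩
    have hs : s ≠ 0 := by
      rintro rfl
      apply hbC
      simpa using h1
    have h3 : 2 * s ^ 2 + a = 0 := by
      have : (2 * s) * (2 * s ^ 2 + a) = 0 := by linear_combination h2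
      rcases mul_eq_zero.mp this with h | h
      · simp [hs] at h
      · exact h
    have : (a : ℂ) ^ 2 = 4 * b := by
      linear_combination (-4) * h1 + (2 * s ^ 2 + a) * h3
    exact_mod_cast this
  · intro h
    have hC : (a : ℂ) ^ 2 = 4 * b := by exact_mod_cast h
    obtain ⟨s, hs⟩ := IsAlgClosed.exists_pow_nat_eq (-(a : ℂ) / 2) (n := 2) (by norm_num)
    refine ⟨s, ?_, ?_⟩
    · linear_combination (s ^ 2 + a / 2) * hs - hC / 4
    · linear_combination (4 * s) * hs

lemma real_aux (p q g P G : ℝ) (hp : p ≠ 0) (hq : q ≠ 0) (hP : P ≠ 0) (hG : G ≠ 0)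
    (hg : g * P = G ^ 2) :
    (p + q + g) ^ 2 = 4 * (p * q) ↔ (p * q > 0 ∧ p * P < 0 ∧
      ∃ δ : ℝ, (δ = 1 ∨ δ = -1) ∧ G ^ 2 = (√|p| + δ * √|q|) ^ 2 * |P|) := by
  have hG2 : 0 < G ^ 2 := by positivity
  have hx : √|p| ^ 2 = |p| := Real.sq_sqrt (abs_nonneg p)
  have hy : √|q| ^ 2 = |q| := Real.sq_sqrt (abs_nonneg q)
  generalize √|p| = x at *
  generalize √|q| = y at *
  constructor
  · intro h
    have hpq : p * q > 0 := by
      have : p * q ≠ 0 := mul_ne_zero hp hq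
      have : 0 ≤ p * q := by nlinarith [sq_nonneg (p + q + g)]
      positivity
    -- `e` is the common sign of `p` and `q`
    obtain ⟨e, he, hpe, hqe, hpx⟩ : ∃ e : ℝ, e * e = 1 ∧ p = e * x ^ 2 ∧ q = e * y ^ 2 ∧
        0 < e * p := by
      rcases lt_or_gt_of_ne hp with h0 | h0
      · have hq0 : q < 0 := by nlinarith
        rw [abs_of_neg h0] at hx
        rw [abs_of_neg hq0] at hy
        exact ⟨-1, by norm_num, by linarith, by linarith, by linarith⟩
      · have hq0 : 0 < q := by nlinarith
        rw [abs_of_pos h0] at hx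
        rw [abs_of_pos hq0] at hy
        exact ⟨1, by norm_num, by linarith, by linarith, by linarith⟩
    have hfac : (e * g + (x + y) ^ 2) * (e * g + (x - y) ^ 2) = 0 := by
      subst hpe hqe
      linear_combination h + (g ^ 2 - (x ^ 2 - y ^ 2) ^ 2) * he
    obtain ⟨δ, hδ, hgδ⟩ : ∃ δ : ℝ, (δ = 1 ∨ δ = -1) ∧ e * g = -(x + δ * y) ^ 2 := by
      rcases mul_eq_zero.mp hfac with h1 | h1
      · exact ⟨1, Or.inl rfl, by linear_combination h1⟩
      · exact ⟨-1, Or.inr rfl, by linear_combination h1⟩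
    have hGe : G ^ 2 = (x + δ * y) ^ 2 * (-(e * P)) := by
      linear_combination -hg - g * P * he + e * P * hgδ
    have heP : e * P < 0 := by
      by_contra hc
      push Not at hc
      nlinarith [mul_nonneg (sq_nonneg (x + δ * y)) hc]
    have habs : |P| = -(e * P) := by
      have : |e| = 1 := by
        rcases mul_self_eq_one_iff.mp he with h1 | h1 <;> simp [h1]
      rw [← abs_of_neg heP, abs_mul, this, one_mul]
    refine ⟨hpq, ?_, δ, hδ, by rw [habs]; exact hGe⟩
    have : p * P = (e * p) * (e * P) := by linear_combination (-p * P) * he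
    rw [this]
    exact mul_neg_of_pos_of_neg hpx heP
  · rintro ⟨hpq, hpP, δ, hδ, hGδ⟩
    have hδ2 : δ ^ 2 = 1 := by rcases hδ with rfl | rfl <;> norm_num
    rcases lt_or_gt_of_ne hp with h0 | h0
    · have hq0 : q < 0 := by nlinarith
      have hP0 : 0 < P := by nlinarith
      rw [abs_of_neg h0] at hx
      rw [abs_of_neg hq0] at hy
      rw [abs_of_pos hP0] at hGδ
      have hg' : g = (x + δ * y) ^ 2 := mul_right_cancel₀ hP (hg.trans hGδ)
      have : p + q + g = 2 * δ * x * y := by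
        linear_combination hg' + hx + hy + y ^ 2 * hδ2
      rw [this]
      linear_combination 4 * x ^ 2 * y ^ 2 * hδ2 + 4 * y ^ 2 * hx - 4 * p * hy
    · have hq0 : 0 < q := by nlinarith
      have hP0 : P < 0 := by nlinarith
      rw [abs_of_pos h0] at hx
      rw [abs_of_pos hq0] at hy
      rw [abs_of_neg hP0] at hGδ
      have hg' : g = -(x + δ * y) ^ 2 := mul_right_cancel₀ hP (by rw [hg, hGδ]; ring)
      have : p + q + g = -(2 * δ * x * y) := by
        linear_combination hg' - hx - hy - y ^ 2 * hδ2
      rw [this]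
      linear_combination 4 * x ^ 2 * y ^ 2 * hδ2 + 4 * y ^ 2 * hx + 4 * p * hy

/-- The companion matrix 𝒞 has a degenerate eigenvalue (a complex
root of its characteristic polynomial of multiplicity ≥ 2) if and only if
ξ₁·ξ₂ > 0, ξ₁·(L₁L₂) < 0, and G₁² = (√|ξ₁| + δ·√|ξ₂|)²·|L₁L₂| for some
δ ∈ {1, −1}, where ξ₁ = 1/(L₁C₁), ξ₂ = 1/(L₂C₂). -/
theorem degenerate_eigenvalue_iff
    (L₁ C₁ L₂ C₂ G₁ : ℝ) (hL₁ : L₁ ≠ 0) (hC₁ : C₁ ≠ 0) (hL₂ : L₂ ≠ 0)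
    (hC₂ : C₂ ≠ 0) (hG₁ : G₁ ≠ 0) :
    (∃ s₀ : ℂ,
      2 ≤ Polynomial.rootMultiplicity s₀
        (((!![0, 0, 1, 0;
              0, 0, 0, 1;
              -(1/(L₁*C₁)), 0, 0, G₁/L₁;
              0, -(1/(L₂*C₂)), -(G₁/L₂), 0] : Matrix (Fin 4) (Fin 4) ℝ).charpoly).map
            (algebraMap ℝ ℂ))) ↔
    ((1/(L₁*C₁)) * (1/(L₂*C₂)) > 0 ∧
     (1/(L₁*C₁)) * (L₁*L₂) < 0 ∧
     ∃ δ : ℝ, (δ = 1 ∨ δ = -1) ∧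
       G₁^2 = (Real.sqrt |1/(L₁*C₁)| + δ * Real.sqrt |1/(L₂*C₂)|)^2 * |L₁*L₂|) := by

  have hp : 1 / (L₁ * C₁) ≠ 0 := by positivity
  have hq : 1 / (L₂ * C₂) ≠ 0 := by positivity
  rw [charpoly_aux, double_root_aux _ _ (mul_ne_zero hp hq)]
  exact real_aux _ _ _ _ _ hp hq (mul_ne_zero hL₁ hL₂) hG₁ (by field_simp)
end

section
/- Assume ξ₁·ξ₂ > 0, let σ = 1 if ξ₁ > 0 and σ = −1 if ξ₁ < 0, and assume σ·(L₁L₂) < 0. Let δ ∈ {1, −1} and suppose G₁² = (√|ξ₁| + δ·√|ξ₂|)²·|L₁L₂|. Then the characteristic polynomial of the companion matrix 𝒞 factors as (X² − σδ·√(|ξ₁|·|ξ₂|))², as an identity of real polynomials; in particular 𝒞 has exactly two eigenvalues ±s₀ with s₀² = σδ·√(|ξ₁|·|ξ₂|), each of algebraic multiplicity 2, and these are real when δ = σ and purely imaginary when δ = −σ. -/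
open Polynomial Matrix

theorem gyr_charpoly (a b p q : ℝ) :
    Matrix.charpoly (!![0, 0, 1, 0; 0, 0, 0, 1; -a, 0, 0, p; 0, -b, -q, 0] :
      Matrix (Fin 4) (Fin 4) ℝ) =
      X ^ 4 + Polynomial.C (a + b + p * q) * X ^ 2 + Polynomial.C (a * b) := by
  have h : Matrix.charmatrix (!![0, 0, 1, 0; 0, 0, 0, 1; -a, 0, 0, p; 0, -b, -q, 0] :
      Matrix (Fin 4) (Fin 4) ℝ) =
      !![X, 0, -1, 0; 0, X, 0, -1; Polynomial.C a, 0, X, -Polynomial.C p;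
        0, Polynomial.C b, Polynomial.C q, X] := by
    ext1 i j
    fin_cases i <;> fin_cases j <;> simp [Matrix.charmatrix_apply]
  rw [Matrix.charpoly, h, Matrix.det_succ_row_zero]
  simp only [Fin.sum_univ_four, Matrix.det_fin_three, Matrix.submatrix_apply]
  simp [Fin.succAbove, Fin.lt_def]
  ring

theorem gyr_mult (c s : ℂ) (hc : c ≠ 0) (hs : s ^ 2 = c) :
    Polynomial.rootMultiplicity s ((X ^ 2 - Polynomial.C c) ^ 2) = 2 := by
  have hs0 : s ≠ 0 := by
    rintro rfl
    apply hc
    rw [← hs]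
    ring
  have hf : ((X ^ 2 - Polynomial.C c) ^ 2 : ℂ[X]) =
      (X + Polynomial.C s) ^ 2 * (X - Polynomial.C s) ^ 2 := by
    rw [← hs, Polynomial.C_pow]
    ring
  have hr : ¬ ((X + Polynomial.C s) ^ 2 : ℂ[X]).IsRoot s := by
    simp only [Polynomial.IsRoot.def, Polynomial.eval_pow, Polynomial.eval_add,
      Polynomial.eval_X, Polynomial.eval_C]
    apply pow_ne_zero
    rw [← two_mul]
    exact mul_ne_zero two_ne_zero hs0
  have hne : ((X + Polynomial.C s) ^ 2 : ℂ[X]) ≠ 0 := by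
    intro h
    apply hr
    rw [h]
    simp
  rw [hf, Polynomial.rootMultiplicity_mul_X_sub_C_pow hne,
    Polynomial.rootMultiplicity_eq_zero hr]

/-- Under the sign constraints and with the gyration parameter at a
special value, the characteristic polynomial of 𝒞 factors as
(X² − σδ·√(|ξ₁|·|ξ₂|))²; in particular 𝒞 has exactly two eigenvalues ±s₀ with
s₀² = σδ·√(|ξ₁|·|ξ₂|), each of algebraic multiplicity 2, real when δ = σ and
purely imaginary when δ = −σ. -/
theorem special_gyration_charpoly_factorization
    (L₁ C₁ L₂ C₂ G₁ : ℝ) (hL₁ : L₁ ≠ 0) (hC₁ : C₁ ≠ 0) (hL₂ : L₂ ≠ 0)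
    (hC₂ : C₂ ≠ 0) (hG₁ : G₁ ≠ 0)
    (σ δ : ℝ)
    (hξ : (1/(L₁*C₁)) * (1/(L₂*C₂)) > 0)
    (hσ : σ = if 0 < 1/(L₁*C₁) then 1 else -1)
    (hsign : σ * (L₁*L₂) < 0)
    (hδ : δ = 1 ∨ δ = -1)
    (hG : G₁^2 = (Real.sqrt |1/(L₁*C₁)| + δ * Real.sqrt |1/(L₂*C₂)|)^2 * |L₁*L₂|) :
    Matrix.charpoly
      (!![0, 0, 1, 0;
          0, 0, 0, 1;
          -(1/(L₁*C₁)), 0, 0, G₁/L₁;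
          0, -(1/(L₂*C₂)), -(G₁/L₂), 0] : Matrix (Fin 4) (Fin 4) ℝ) =
      (X ^ 2 - Polynomial.C (σ * δ * Real.sqrt (|1/(L₁*C₁)| * |1/(L₂*C₂)|))) ^ 2 ∧
    (∀ s : ℂ,
      (((!![0, 0, 1, 0;
            0, 0, 0, 1;
            -(1/(L₁*C₁)), 0, 0, G₁/L₁;
            0, -(1/(L₂*C₂)), -(G₁/L₂), 0] : Matrix (Fin 4) (Fin 4) ℝ).charpoly).map
          (algebraMap ℝ ℂ)).IsRoot s ↔
        s ^ 2 = ((σ * δ * Real.sqrt (|1/(L₁*C₁)| * |1/(L₂*C₂)|) : ℝ) : ℂ)) ∧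
    (∀ s : ℂ,
      (((!![0, 0, 1, 0;
            0, 0, 0, 1;
            -(1/(L₁*C₁)), 0, 0, G₁/L₁;
            0, -(1/(L₂*C₂)), -(G₁/L₂), 0] : Matrix (Fin 4) (Fin 4) ℝ).charpoly).map
          (algebraMap ℝ ℂ)).IsRoot s →
        Polynomial.rootMultiplicity s
          (((!![0, 0, 1, 0;
                0, 0, 0, 1;
                -(1/(L₁*C₁)), 0, 0, G₁/L₁;
                0, -(1/(L₂*C₂)), -(G₁/L₂), 0] : Matrix (Fin 4) (Fin 4) ℝ).charpoly).map
              (algebraMap ℝ ℂ)) = 2) ∧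
    (δ = σ →
      ∀ s : ℂ,
        (((!![0, 0, 1, 0;
              0, 0, 0, 1;
              -(1/(L₁*C₁)), 0, 0, G₁/L₁;
              0, -(1/(L₂*C₂)), -(G₁/L₂), 0] : Matrix (Fin 4) (Fin 4) ℝ).charpoly).map
            (algebraMap ℝ ℂ)).IsRoot s → s.im = 0) ∧
    (δ = -σ →
      ∀ s : ℂ,
        (((!![0, 0, 1, 0;
              0, 0, 0, 1;
              -(1/(L₁*C₁)), 0, 0, G₁/L₁;
              0, -(1/(L₂*C₂)), -(G₁/L₂), 0] : Matrix (Fin 4) (Fin 4) ℝ).charpoly).map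
            (algebraMap ℝ ℂ)).IsRoot s → s.re = 0) := by
  have hL : L₁ * L₂ ≠ 0 := mul_ne_zero hL₁ hL₂
  have hpq : G₁ / L₁ * (G₁ / L₂) = G₁ ^ 2 / (L₁ * L₂) := by
    field_simp
  generalize hM : (!![0, 0, 1, 0; 0, 0, 0, 1; -(1/(L₁*C₁)), 0, 0, G₁/L₁;
    0, -(1/(L₂*C₂)), -(G₁/L₂), 0] : Matrix (Fin 4) (Fin 4) ℝ) = M
  have hcp := gyr_charpoly (1/(L₁*C₁)) (1/(L₂*C₂)) (G₁/L₁) (G₁/L₂)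
  rw [hM, hpq] at hcp
  clear hM hpq
  generalize 1/(L₁*C₁) = x at *
  generalize 1/(L₂*C₂) = y at *
  generalize L₁ * L₂ = l at *
  have hx0 : x ≠ 0 := left_ne_zero_of_mul hξ.ne'
  have hy0 : y ≠ 0 := right_ne_zero_of_mul hξ.ne'
  have hσ2 : σ ^ 2 = 1 := by rw [hσ]; split_ifs <;> norm_num
  have hδ2 : δ ^ 2 = 1 := by rcases hδ with h | h <;> rw [h] <;> norm_num
  have key : x = σ * |x| ∧ y = σ * |y| ∧ |l| = - σ * l := by
    by_cases h : 0 < x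
    · have hy : 0 < y := (pos_iff_pos_of_mul_pos hξ).1 h
      rw [if_pos h] at hσ
      subst hσ
      refine ⟨?_, ?_, ?_⟩
      · rw [abs_of_pos h]; ring
      · rw [abs_of_pos hy]; ring
      · rw [abs_of_neg (by linarith)]; ring
    · have hx : x < 0 := lt_of_le_of_ne (not_lt.1 h) hx0
      have hy : y < 0 := (neg_iff_neg_of_mul_pos hξ).1 hx
      rw [if_neg h] at hσ
      subst hσ
      refine ⟨?_, ?_, ?_⟩
      · rw [abs_of_neg hx]; ring
      · rw [abs_of_neg hy]; ring
      · rw [abs_of_pos (by linarith)]; ring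
  obtain ⟨hx, hy, hl⟩ := key
  have hr : 0 < Real.sqrt (|x| * |y|) :=
    Real.sqrt_pos.2 (mul_pos (abs_pos.2 hx0) (abs_pos.2 hy0))
  have hxy : x * y = (σ * δ * Real.sqrt (|x| * |y|)) ^ 2 := by
    rw [mul_pow, mul_pow, hσ2, hδ2, Real.sq_sqrt (by positivity), ← abs_mul, abs_of_pos hξ]
    ring
  have hsum : x + y + G₁ ^ 2 / l = -2 * (σ * δ * Real.sqrt (|x| * |y|)) := by
    have h1 := Real.sq_sqrt (abs_nonneg x)
    have h2 := Real.sq_sqrt (abs_nonneg y)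
    have h3 : G₁ ^ 2 / l = -σ * (Real.sqrt |x| + δ * Real.sqrt |y|) ^ 2 := by
      rw [hG, hl]
      field_simp
    rw [h3, Real.sqrt_mul (abs_nonneg x)]
    linear_combination hx + hy - σ * h1 - σ * h2 - σ * Real.sqrt |y| ^ 2 * hδ2
  have hmain : M.charpoly =
      (X ^ 2 - Polynomial.C (σ * δ * Real.sqrt (|x| * |y|))) ^ 2 := by
    rw [hcp, hxy, hsum]
    simp only [Polynomial.C_mul, Polynomial.C_pow, Polynomial.C_neg, Polynomial.C_ofNat]
    ring
  generalize Real.sqrt (|x| * |y|) = r at *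
  have hc0 : ((σ * δ * r : ℝ) : ℂ) ≠ 0 := by
    rw [Complex.ofReal_ne_zero]
    refine mul_ne_zero (mul_ne_zero ?_ ?_) hr.ne'
    · rintro rfl; norm_num at hσ2
    · rintro rfl; norm_num at hδ2
  have hmap : M.charpoly.map (algebraMap ℝ ℂ) =
      (X ^ 2 - Polynomial.C ((σ * δ * r : ℝ) : ℂ)) ^ 2 := by
    rw [hmain, Polynomial.map_pow, Polynomial.map_sub, Polynomial.map_pow, Polynomial.map_X,
      Polynomial.map_C]
    rfl
  have hroot : ∀ s : ℂ, (M.charpoly.map (algebraMap ℝ ℂ)).IsRoot s ↔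
      s ^ 2 = ((σ * δ * r : ℝ) : ℂ) := by
    intro s
    rw [hmap, Polynomial.IsRoot.def, Polynomial.eval_pow, Polynomial.eval_sub,
      Polynomial.eval_pow, Polynomial.eval_X, Polynomial.eval_C, sq_eq_zero_iff, sub_eq_zero]
  refine ⟨hmain, hroot, ?_, ?_, ?_⟩
  · intro s hs
    rw [hmap]
    exact gyr_mult _ s hc0 ((hroot s).1 hs)
  · intro h s hs
    have h1 := (hroot s).1 hs
    have hre := congrArg Complex.re h1
    have him := congrArg Complex.im h1
    rw [Complex.ofReal_re, sq, Complex.mul_re] at hre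
    rw [Complex.ofReal_im, sq, Complex.mul_im] at him
    have h3 : σ * δ = 1 := by rw [h, ← hσ2]; ring
    rw [h3] at hre
    have h4 : s.re * s.im = 0 := by linarith
    rcases mul_eq_zero.1 h4 with h5 | h5
    · rw [h5] at hre
      nlinarith [mul_self_nonneg s.im]
    · exact h5
  · intro h s hs
    have h1 := (hroot s).1 hs
    have hre := congrArg Complex.re h1
    have him := congrArg Complex.im h1
    rw [Complex.ofReal_re, sq, Complex.mul_re] at hre
    rw [Complex.ofReal_im, sq, Complex.mul_im] at him
    have h3 : σ * δ = -1 := by rw [h, ← hσ2]; ring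
    rw [h3] at hre
    have h4 : s.re * s.im = 0 := by linarith
    rcases mul_eq_zero.1 h4 with h5 | h5
    · exact h5
    · rw [h5] at hre
      nlinarith [mul_self_nonneg s.re]
end

section
/- Assume ξ₁·ξ₂ > 0. If s ∈ ℂ is a root of the characteristic polynomial χ of the companion matrix 𝒞, then s ≠ 0, and both −s and √(ξ₁ξ₂)/s (with √(ξ₁ξ₂) the positive real square root) are also roots of χ; consequently the set of roots is invariant under the quadruple map s ↦ {s, √(ξ₁ξ₂)/s, −s, −√(ξ₁ξ₂)/s}. -/
open Polynomial Matrix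

theorem companion_root_iff (x y a b : ℝ) (z : ℂ) :
    (((!![0, 0, 1, 0;
          0, 0, 0, 1;
          -x, 0, 0, a;
          0, -y, -b, 0] : Matrix (Fin 4) (Fin 4) ℝ).charpoly).map
        (algebraMap ℝ ℂ)).IsRoot z ↔
      z ^ 4 + ((x : ℂ) + y + a * b) * z ^ 2 + x * y = 0 := by
  have h : (!![0, 0, 1, 0;
          0, 0, 0, 1;
          -x, 0, 0, a;
          0, -y, -b, 0] : Matrix (Fin 4) (Fin 4) ℝ).charpoly
      = X ^ 4 + (C x + C y + C a * C b) * X ^ 2 + C x * C y := by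
    simp [Matrix.charpoly, Matrix.charmatrix, Matrix.det_succ_row_zero, Fin.sum_univ_succ,
      Fin.succAbove, Matrix.diagonal_apply]
    ring
  rw [h]
  simp [Polynomial.IsRoot.def]

/-- Assume ξ₁·ξ₂ > 0. If s is a complex root of the characteristic
polynomial χ of 𝒞, then s ≠ 0 and both −s and √(ξ₁ξ₂)/s (and hence also
−√(ξ₁ξ₂)/s) are roots of χ: the set of roots is invariant under the quadruple
map. -/
theorem roots_quadruple_invariance
    (L₁ C₁ L₂ C₂ G₁ : ℝ) (hL₁ : L₁ ≠ 0) (hC₁ : C₁ ≠ 0) (hL₂ : L₂ ≠ 0)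
    (hC₂ : C₂ ≠ 0) (hG₁ : G₁ ≠ 0)
    (hξ : (1/(L₁*C₁)) * (1/(L₂*C₂)) > 0)
    (s : ℂ)
    (hroot :
      (((!![0, 0, 1, 0;
            0, 0, 0, 1;
            -(1/(L₁*C₁)), 0, 0, G₁/L₁;
            0, -(1/(L₂*C₂)), -(G₁/L₂), 0] : Matrix (Fin 4) (Fin 4) ℝ).charpoly).map
          (algebraMap ℝ ℂ)).IsRoot s) :
    s ≠ 0 ∧
    (((!![0, 0, 1, 0;
          0, 0, 0, 1;
          -(1/(L₁*C₁)), 0, 0, G₁/L₁;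
          0, -(1/(L₂*C₂)), -(G₁/L₂), 0] : Matrix (Fin 4) (Fin 4) ℝ).charpoly).map
        (algebraMap ℝ ℂ)).IsRoot (-s) ∧
    (((!![0, 0, 1, 0;
          0, 0, 0, 1;
          -(1/(L₁*C₁)), 0, 0, G₁/L₁;
          0, -(1/(L₂*C₂)), -(G₁/L₂), 0] : Matrix (Fin 4) (Fin 4) ℝ).charpoly).map
        (algebraMap ℝ ℂ)).IsRoot
      ((Real.sqrt ((1/(L₁*C₁)) * (1/(L₂*C₂))) : ℂ) / s) ∧
    (((!![0, 0, 1, 0;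
          0, 0, 0, 1;
          -(1/(L₁*C₁)), 0, 0, G₁/L₁;
          0, -(1/(L₂*C₂)), -(G₁/L₂), 0] : Matrix (Fin 4) (Fin 4) ℝ).charpoly).map
        (algebraMap ℝ ℂ)).IsRoot
      (-((Real.sqrt ((1/(L₁*C₁)) * (1/(L₂*C₂))) : ℂ) / s)) := by
  rw [companion_root_iff] at hroot
  simp only [companion_root_iff]
  generalize 1/(L₁*C₁) = x at *
  generalize 1/(L₂*C₂) = y at *
  generalize G₁/L₁ = a at *
  generalize G₁/L₂ = b at *
  have hr2 : ((Real.sqrt (x * y) : ℝ) : ℂ) ^ 2 = x * y := by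
    rw [← Complex.ofReal_pow, Real.sq_sqrt hξ.le, Complex.ofReal_mul]
  have hxy : (x : ℂ) * y ≠ 0 := by
    rw [← Complex.ofReal_mul]
    exact Complex.ofReal_ne_zero.mpr hξ.ne'
  generalize ((Real.sqrt (x * y) : ℝ) : ℂ) = r at *
  have hs : s ≠ 0 := by
    rintro rfl
    apply hxy
    simpa using hroot
  have key : (r / s) ^ 4 + ((x : ℂ) + y + a * b) * (r / s) ^ 2 + x * y = 0 := by
    rw [← hr2] at hroot ⊢
    field_simp
    linear_combination r ^ 2 * hroot
  refine ⟨hs, ?_, key, ?_⟩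
  · linear_combination hroot
  · linear_combination key
end

section
/- The characteristic polynomial of the principal Hamiltonian matrix 𝓗_a satisfies χ_a(s) = det(s·I_{2n} − 𝓗_a) = s^{2n} + (−1)ⁿ·Σ_{k=0}^{n−1} a_k·s^{2k}, as an identity of polynomials with real coefficients; in particular χ_a is an even polynomial. -/
open Polynomial Matrix

/-- A sum against the shift matrix entry picks the next entry. -/
lemma ph_sum_shift (m : ℕ) (f : ℕ → ℝ) (j : Fin (m+1)) :
    (∑ i : Fin (m+1), (if (j:ℕ) + 1 = (i:ℕ) then f i else 0)) =
      if (j:ℕ) < m then f ((j:ℕ)+1) else 0 := by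
  rw [Fin.sum_univ_eq_sum_range (fun i => if (j:ℕ) + 1 = i then f i else 0) (m+1),
    Finset.sum_ite_eq]
  simp

lemma ph_det_eval (m : ℕ) (a : Fin (m+1) → ℝ) (s : ℝ) (hs : s ≠ 0)
    (K A F P D : Matrix (Fin (m+1)) (Fin (m+1)) ℝ)
    (hK : K = Matrix.of fun i j : Fin (m+1) => if (i:ℕ) + 1 = (j:ℕ) then (1:ℝ) else 0)
    (hF : F = Matrix.diagonal fun k : Fin (m+1) => (-1:ℝ)^(k:ℕ) * a k)
    (hP : P = Matrix.diagonal fun k : Fin (m+1) => if (k:ℕ) = m then (1:ℝ) else 0)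
    (hA : A = s • (1 : Matrix (Fin (m+1)) (Fin (m+1)) ℝ) - Kᵀ)
    (hD : D = s • (1 : Matrix (Fin (m+1)) (Fin (m+1)) ℝ) + K) :
    (Matrix.fromBlocks A (-F) (-P) D).det =
      s ^ (2*(m+1)) + (-1:ℝ)^(m+1) * ∑ k : Fin (m+1), a k * s ^ (2*(k:ℕ)) := by
  have dA : A.det = s ^ (m+1) := by
    rw [Matrix.det_of_lowerTriangular]
    · simp [hA, hK]
    · intro i j hij
      have hij' : (i:ℕ) < j := hij
      simp [hA, hK, Matrix.one_apply, Fin.ext_iff, hij'.ne]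
      omega
  have dD : D.det = s ^ (m+1) := by
    rw [Matrix.det_of_upperTriangular]
    · simp [hD, hK]
    · intro i j hij
      have hij' : (j:ℕ) < i := hij
      simp [hD, hK, Matrix.one_apply, Fin.ext_iff, hij'.ne']
      omega
  have uA : IsUnit A.det := by rw [dA]; exact (pow_ne_zero _ hs).isUnit
  let e : Fin (m+1) → ℝ := fun k => if (k:ℕ) = m then 1 else 0
  let g : Fin (m+1) → ℝ := fun k => s⁻¹ ^ (m - (k:ℕ) + 1)
  let h : Fin (m+1) → ℝ := fun k => (-1)^(m - (k:ℕ)) * s⁻¹ ^ (m - (k:ℕ) + 1)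
  have hg : g ᵥ* A = e := by
    rw [hA, Matrix.vecMul_sub, Matrix.vecMul_transpose]
    ext j
    have h1 : (K *ᵥ g) j = if (j:ℕ) < m then s⁻¹ ^ (m - ((j:ℕ)+1) + 1) else 0 := by
      rw [← ph_sum_shift m (fun k => s⁻¹ ^ (m - k + 1)) j]
      simp [Matrix.mulVec, dotProduct, hK, g]
    simp only [Pi.sub_apply, h1, Matrix.vecMul_smul, Matrix.vecMul_one, Pi.smul_apply, smul_eq_mul]
    have hj : (j:ℕ) ≤ m := by omega
    rcases hj.lt_or_eq with hj | hj
    · have : m - (j:ℕ) = m - ((j:ℕ)+1) + 1 := by omega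
      simp only [g, e, hj, hj.ne, if_true, if_false, this]
      rw [pow_succ _ (m - ((j:ℕ)+1) + 1)]
      field_simp
      simp
    · simp [g, e, hj, hs]
  have hh : D *ᵥ h = e := by
    rw [hD, Matrix.add_mulVec]
    ext j
    have h1 : (K *ᵥ h) j =
        if (j:ℕ) < m then (-1)^(m - ((j:ℕ)+1)) * s⁻¹ ^ (m - ((j:ℕ)+1) + 1) else 0 := by
      rw [← ph_sum_shift m (fun k => (-1)^(m - k) * s⁻¹ ^ (m - k + 1)) j]
      simp [Matrix.mulVec, dotProduct, hK, h]
    simp only [Pi.add_apply, h1, Matrix.smul_mulVec, Matrix.one_mulVec, Pi.smul_apply, smul_eq_mul]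
    have hj : (j:ℕ) ≤ m := by omega
    rcases hj.lt_or_eq with hj | hj
    · have : m - (j:ℕ) = m - ((j:ℕ)+1) + 1 := by omega
      simp only [h, e, hj, hj.ne, if_true, if_false, this]
      rw [pow_succ _ (m - ((j:ℕ)+1) + 1), pow_succ (-1:ℝ)]
      field_simp
      simp
    · simp [h, e, hj, hs]
  have hPe : P = Matrix.vecMulVec e e := by
    ext i j
    simp only [hP, Matrix.diagonal_apply, Matrix.vecMulVec_apply, e, Fin.ext_iff]
    split_ifs <;> first | omega | simp
  have hPA : P * A⁻¹ = Matrix.vecMulVec e g := by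
    rw [hPe]
    conv_lhs => rw [← hg, ← Matrix.vecMulVec_mul, Matrix.mul_assoc, Matrix.mul_nonsing_inv _ uA,
      Matrix.mul_one, hg]
  letI := Matrix.invertibleOfIsUnitDet A uA
  rw [Matrix.det_fromBlocks₁₁, Matrix.invOf_eq_nonsing_inv]
  have e1 : D - -P * A⁻¹ * -F = D * (1 + Matrix.vecMulVec (-h) (g ᵥ* F)) := by
    rw [Matrix.mul_add, Matrix.mul_one, Matrix.mul_vecMulVec, Matrix.mulVec_neg, hh,
      Matrix.neg_mul, Matrix.neg_mul, Matrix.mul_neg, neg_neg, hPA, Matrix.vecMulVec_mul, Matrix.neg_vecMulVec,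
      sub_eq_add_neg]
  rw [e1, Matrix.det_mul, dA, dD, Matrix.vecMulVec_eq Unit,
    Matrix.det_one_add_replicateCol_mul_replicateRow]
  have e2 : (g ᵥ* F) ⬝ᵥ -h =
      ∑ k : Fin (m+1), (-1:ℝ)^(m+1) * a k * (s⁻¹ ^ (2 * (m - (k:ℕ) + 1))) := by
    simp only [dotProduct, hF, Matrix.vecMul_diagonal, Pi.neg_apply, g, h]
    refine Finset.sum_congr rfl fun k _ => ?_
    have : (-1:ℝ)^(m+1) = -((-1)^(k:ℕ) * (-1)^(m-(k:ℕ))) := by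
      rw [← pow_add, Nat.add_sub_cancel' (by omega), pow_succ]; ring
    rw [this]; ring
  rw [e2, ← mul_assoc, mul_add, mul_one, Finset.mul_sum, Finset.mul_sum]
  congr 1
  · ring
  · refine Finset.sum_congr rfl fun k _ => ?_
    have : s ^ (m+1) * s ^ (m+1) = s ^ (2*(k:ℕ)) * s ^ (2 * (m - (k:ℕ) + 1)) := by
      rw [← pow_add, ← pow_add]; congr 1; omega
    rw [this, inv_pow]
    field_simp

/-- The characteristic polynomial of the principal Hamiltonian
matrix 𝓗_a = [[K_nᵀ, F_a], [π_n, −K_n]] equals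
s^{2n} + (−1)ⁿ·Σ_{k=0}^{n−1} a_k·s^{2k}; in particular it is even. -/
theorem principal_hamiltonian_charpoly
    (n : ℕ) (hn : 1 ≤ n) (a : Fin n → ℝ) :
    Matrix.charpoly
      (Matrix.fromBlocks
        (Matrix.of fun i j : Fin n => if (i:ℕ) + 1 = (j:ℕ) then (1:ℝ) else 0)ᵀ
        (Matrix.diagonal fun k : Fin n => (-1:ℝ)^(k:ℕ) * a k)
        (Matrix.diagonal fun k : Fin n => if (k:ℕ) = n - 1 then (1:ℝ) else 0)
        (-(Matrix.of fun i j : Fin n => if (i:ℕ) + 1 = (j:ℕ) then (1:ℝ) else 0))) =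
    X ^ (2*n) + Polynomial.C ((-1:ℝ)^n) *
      ∑ k : Fin n, Polynomial.C (a k) * X ^ (2*(k:ℕ)) := by
  obtain ⟨m, rfl⟩ : ∃ m, n = m + 1 := ⟨n - 1, by omega⟩
  refine Polynomial.eq_of_infinite_eval_eq _ _ ((Set.Ioi_infinite (0:ℝ)).mono ?_)
  intro s hs
  have hs' : s ≠ 0 := ne_of_gt hs
  rw [Set.mem_setOf_eq, Matrix.eval_charpoly]
  have key := ph_det_eval m a s hs' _ _ _ _ _ rfl rfl rfl rfl rfl
  simp only [Polynomial.eval_add, Polynomial.eval_mul, Polynomial.eval_pow, Polynomial.eval_X,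
    Polynomial.eval_C, Polynomial.eval_finset_sum]
  rw [← key]
  congr 1
  rw [Matrix.scalar_apply, ← Matrix.smul_one_eq_diagonal, ← Matrix.fromBlocks_one,
    Matrix.fromBlocks_smul, sub_eq_add_neg, Matrix.fromBlocks_neg, Matrix.fromBlocks_add]
  simp [sub_eq_add_neg]
end

section
/- Suppose a₀ ≠ 0 and let s ∈ ℂ satisfy χ_a(s) = 0, where χ_a(s) = s^{2n} + (−1)ⁿ·Σ_{k=0}^{n−1} a_k·s^{2k}. Define Z(s) ∈ ℂ^{2n} by Z(s)_j = q_j(s) for 1 ≤ j ≤ n and Z(s)_{n+j} = p_j(s) for 1 ≤ j ≤ n, where q_j(s) = (−1)^{n−1}·Σ_{k=1}^{j} a_{k−1}·s^{n−j+2(k−1)} and p_j(s) = (−1)^{n+j}·s^{n+j−1}. Then Z(s) ≠ 0 and 𝓗_a·Z(s) = s·Z(s); i.e. Z(s) is an eigenvector of 𝓗_a with eigenvalue s. -/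
open Polynomial Matrix

/-- The principal Hamiltonian matrix 𝓗_a = [[K_nᵀ, F_a], [π_n, −K_n]]. -/
noncomputable def principalHamiltonianMatrix (n : ℕ) (a : Fin n → ℝ) :
    Matrix (Fin n ⊕ Fin n) (Fin n ⊕ Fin n) ℝ :=
  Matrix.fromBlocks
    (Matrix.of fun i j : Fin n => if (i:ℕ) + 1 = (j:ℕ) then (1:ℝ) else 0)ᵀ
    (Matrix.diagonal fun k : Fin n => (-1:ℝ)^(k:ℕ) * a k)
    (Matrix.diagonal fun k : Fin n => if (k:ℕ) = n - 1 then (1:ℝ) else 0)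
    (-(Matrix.of fun i j : Fin n => if (i:ℕ) + 1 = (j:ℕ) then (1:ℝ) else 0))

/-- The explicit eigenvector Z(s), with upper block the q_j(s) and lower block
the p_j(s) (0-indexed: the j-th coordinate corresponds to index j+1 in the
paper). -/
noncomputable def principalEigenvector (n : ℕ) (a : Fin n → ℝ) (s : ℂ) :
    (Fin n ⊕ Fin n) → ℂ :=
  Sum.elim
    (fun j : Fin n => (-1:ℂ)^(n-1) *
      ∑ k : Fin n, if (k:ℕ) ≤ (j:ℕ) then
        (a k : ℂ) * s^(n - 1 - (j:ℕ) + 2*(k:ℕ)) else 0)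
    (fun j : Fin n => (-1:ℂ)^(n + (j:ℕ) + 1) * s^(n + (j:ℕ)))

/-- If a₀ ≠ 0 and s is a root of
χ_a(s) = s^{2n} + (−1)ⁿ Σ_{k<n} a_k s^{2k}, then the explicit vector Z(s) is a
nonzero eigenvector of 𝓗_a with eigenvalue s. -/
theorem principal_hamiltonian_eigenvector
    (n : ℕ) (hn : 1 ≤ n) (a : Fin n → ℝ) (ha : a ⟨0, hn⟩ ≠ 0) (s : ℂ)
    (hs : s^(2*n) + (-1:ℂ)^n * ∑ k : Fin n, (a k : ℂ) * s^(2*(k:ℕ)) = 0) :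
    principalEigenvector n a s ≠ 0 ∧
    ((principalHamiltonianMatrix n a).map (algebraMap ℝ ℂ)).mulVec
        (principalEigenvector n a s) = s • principalEigenvector n a s := by
  obtain ⟨m, rfl⟩ : ∃ m, n = m + 1 := ⟨n - 1, by omega⟩
  have hs0 : s ≠ 0 := by
    rintro rfl
    rw [Fin.sum_univ_succ] at hs
    simp at hs
    exact ha hs
  refine ⟨?_, ?_⟩
  · intro h
    have h1 := congrFun h (Sum.inr ⟨0, hn⟩)
    simp [principalEigenvector, hs0] at h1
  · ext i
    rcases i with j | j
    · have hL : ((principalHamiltonianMatrix (m+1) a).map (algebraMap ℝ ℂ)).mulVec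
          (principalEigenvector (m+1) a s) (Sum.inl j) =
          (∑ i : Fin (m+1), if (i:ℕ) + 1 = (j:ℕ) then
            principalEigenvector (m+1) a s (Sum.inl i) else 0) +
          (-1:ℂ)^(j:ℕ) * a j * principalEigenvector (m+1) a s (Sum.inr j) := by
        simp only [Matrix.mulVec, dotProduct, Fintype.sum_sum_type]
        congr 1
        · refine Finset.sum_congr rfl fun i _ => ?_
          by_cases h : (i:ℕ) + 1 = (j:ℕ) <;> simp [principalHamiltonianMatrix, h]
        · rw [Finset.sum_eq_single j]
          · simp [principalHamiltonianMatrix]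
          · intro b _ hb
            simp [principalHamiltonianMatrix, Matrix.diagonal_apply_ne' _ hb]
          · simp
      rw [hL]
      have hq : s * principalEigenvector (m+1) a s (Sum.inl j) = (-1:ℂ)^m *
          ((∑ k : Fin (m+1), if (k:ℕ) < (j:ℕ) then
            (a k : ℂ) * s^(m + 1 - (j:ℕ) + 2*(k:ℕ)) else 0) + a j * s^(m+1+(j:ℕ))) := by
        have h1 : (a j : ℂ) * s^(m+1+(j:ℕ)) = ∑ k : Fin (m+1), if k = j then
            (a k : ℂ) * s^(m+1+(k:ℕ)) else 0 := by simp
        rw [h1, ← Finset.sum_add_distrib]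
        simp only [principalEigenvector, Sum.elim_inl, Nat.add_sub_cancel]
        rw [mul_left_comm, Finset.mul_sum]
        congr 1
        refine Finset.sum_congr rfl fun k _ => ?_
        have hj := j.2
        rcases lt_trichotomy (k:ℕ) (j:ℕ) with h | h | h
        · have hne : k ≠ j := fun e => by simp [e] at h
          rw [if_pos h.le, if_pos h, if_neg hne, add_zero, mul_left_comm, ← pow_succ']
          congr 2
          omega
        · have he : k = j := Fin.ext h
          subst he
          rw [if_pos le_rfl, if_neg (lt_irrefl _), if_pos rfl, zero_add, mul_left_comm,
            ← pow_succ']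
          congr 2
          omega
        · have hne : k ≠ j := fun e => by simp [e] at h
          rw [if_neg (by omega), if_neg (by omega), if_neg hne]
          simp
      rw [Pi.smul_apply, smul_eq_mul, hq, mul_add]
      congr 1
      · rcases Nat.eq_zero_or_pos (j:ℕ) with h | h
        · simp [h]
        · have hj := j.2
          rw [Finset.sum_eq_single (⟨(j:ℕ) - 1, by omega⟩ : Fin (m+1))]
          · rw [if_pos (by simp only []; omega)]
            simp only [principalEigenvector, Sum.elim_inl, Nat.add_sub_cancel]
            congr 1
            refine Finset.sum_congr rfl fun k _ => ?_
            have e : m - ((j:ℕ) - 1) = m + 1 - (j:ℕ) := by omega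
            rw [e]
            exact if_congr (by omega) rfl rfl
          · intro b _ hb
            rw [if_neg]
            intro e
            exact hb (Fin.ext (by simp only []; omega))
          · simp
      · simp only [principalEigenvector, Sum.elim_inr]
        have e : (-1:ℂ)^(j:ℕ) * (-1:ℂ)^(j:ℕ) = 1 := by
          rw [← mul_pow]; simp
        have e2 : (-1:ℂ)^(m + 1 + (j:ℕ) + 1) = (-1)^m * (-1)^(j:ℕ) := by ring
        rw [e2]
        linear_combination (-1:ℂ)^m * a j * s^(m+1+(j:ℕ)) * e
    · have hL : ((principalHamiltonianMatrix (m+1) a).map (algebraMap ℝ ℂ)).mulVec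
          (principalEigenvector (m+1) a s) (Sum.inr j) =
          (if (j:ℕ) = m then principalEigenvector (m+1) a s (Sum.inl j) else 0) +
          (∑ i : Fin (m+1), if (j:ℕ) + 1 = (i:ℕ) then
            -principalEigenvector (m+1) a s (Sum.inr i) else 0) := by
        simp only [Matrix.mulVec, dotProduct, Fintype.sum_sum_type]
        congr 1
        · rw [Finset.sum_eq_single j]
          · by_cases h : (j:ℕ) = m <;> simp [principalHamiltonianMatrix, h]
          · intro b _ hb
            simp [principalHamiltonianMatrix, Matrix.diagonal_apply_ne' _ hb]
          · simp
        · refine Finset.sum_congr rfl fun i _ => ?_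
          by_cases h : (j:ℕ) + 1 = (i:ℕ) <;> simp [principalHamiltonianMatrix, h]
      rw [hL, Pi.smul_apply, smul_eq_mul]
      have hj := j.2
      by_cases h : (j:ℕ) = m
      · rw [if_pos h, Finset.sum_eq_zero, add_zero]
        · simp only [principalEigenvector, Sum.elim_inr, Sum.elim_inl, Nat.add_sub_cancel, h]
          have e : (∑ k : Fin (m+1), if (k:ℕ) ≤ m then
              (a k : ℂ) * s^(m - m + 2*(k:ℕ)) else 0) =
              ∑ k : Fin (m+1), (a k : ℂ) * s^(2*(k:ℕ)) := by
            refine Finset.sum_congr rfl fun k _ => ?_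
            rw [if_pos (by omega), Nat.sub_self, zero_add]
          have e2 : (-1:ℂ)^(m + 1 + m + 1) = 1 := Even.neg_one_pow ⟨m+1, by ring⟩
          rw [e, e2]
          linear_combination -hs
        · intro i _
          rw [if_neg (by omega)]
      · rw [if_neg h, zero_add,
          Finset.sum_eq_single (⟨(j:ℕ) + 1, by omega⟩ : Fin (m+1))]
        · rw [if_pos rfl]
          simp only [principalEigenvector, Sum.elim_inr]
          ring
        · intro b _ hb
          rw [if_neg]
          intro e
          exact hb (Fin.ext e.symm)
        · simp
end

section
/- Suppose a₀ ≠ 0. Then the principal Hamiltonian matrix 𝓗_a is similar over ℝ to the companion matrix 𝒞_a of the monic polynomial χ_a(s) = s^{2n} + (−1)ⁿ·Σ_{k=0}^{n−1} a_k·s^{2k}; i.e. there exists an invertible 2n×2n real matrix T with T⁻¹·𝓗_a·T = 𝒞_a, where 𝒞_a is the 2n×2n matrix with (𝒞_a)_{j,j+1} = 1 for 1 ≤ j ≤ 2n−1, last row equal to the negatives of the coefficients of χ_a (so the (2n, 2k+1) entry is (−1)^{n−1}·a_k for 0 ≤ k ≤ n−1 and all other last-row entries are 0), and all other entries 0. 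-/
open Polynomial Matrix

/-- The principal Hamiltonian matrix 𝓗_a = [[K_nᵀ, F_a], [π_n, −K_n]],
reindexed over Fin (n+n). -/
noncomputable def principalHamiltonianMatrix' (n : ℕ) (a : Fin n → ℝ) :
    Matrix (Fin (n + n)) (Fin (n + n)) ℝ :=
  Matrix.reindex finSumFinEquiv finSumFinEquiv
    (Matrix.fromBlocks
      (Matrix.of fun i j : Fin n => if (i:ℕ) + 1 = (j:ℕ) then (1:ℝ) else 0)ᵀ
      (Matrix.diagonal fun k : Fin n => (-1:ℝ)^(k:ℕ) * a k)
      (Matrix.diagonal fun k : Fin n => if (k:ℕ) = n - 1 then (1:ℝ) else 0)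
      (-(Matrix.of fun i j : Fin n => if (i:ℕ) + 1 = (j:ℕ) then (1:ℝ) else 0)))

/-- The companion matrix 𝒞_a of the monic even polynomial
χ_a(s) = s^{2n} + (−1)ⁿ Σ_{k<n} a_k s^{2k}: superdiagonal entries 1 and last
row carrying the negated coefficients, i.e. (−1)^{n−1}·a_k in (0-indexed)
column 2k. -/
noncomputable def principalCompanionMatrix (n : ℕ) (a : Fin n → ℝ) :
    Matrix (Fin (n + n)) (Fin (n + n)) ℝ :=
  Matrix.of fun i j : Fin (n + n) =>
    (if (j:ℕ) = (i:ℕ) + 1 then (1:ℝ) else 0) +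
    (if (i:ℕ) = n + n - 1 then
      ∑ k : Fin n, (if (j:ℕ) = 2*(k:ℕ) then (-1:ℝ)^(n-1) * a k else 0)
     else 0)

namespace PHam

variable {n : ℕ}

/-- y-coordinate (n + i), nat-indexed. -/
noncomputable def Y (v : Fin (n + n) → ℝ) (i : ℕ) : ℝ :=
  if h : i < n then v (Fin.natAdd n ⟨i, h⟩) else 0

/-- reversed x-coordinate n-1-j, zero for j ≥ n. -/
noncomputable def Z (v : Fin (n + n) → ℝ) (j : ℕ) : ℝ :=
  if h : j < n then v (Fin.castAdd n ⟨n - 1 - j, by omega⟩) else 0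

/-- extension of a. -/
noncomputable def A (a : Fin n → ℝ) (i : ℕ) : ℝ := if h : i < n then a ⟨i, h⟩ else 0

/-- observability functionals. -/
noncomputable def r (a : Fin n → ℝ) (k : ℕ) (v : Fin (n + n) → ℝ) : ℝ :=
  Y ((principalHamiltonianMatrix' n a ^ k) *ᵥ v) 0

lemma H_nat (a : Fin n → ℝ) (v : Fin (n + n) → ℝ) (i : Fin n) :
    (principalHamiltonianMatrix' n a *ᵥ v) (Fin.natAdd n i) =
      (if (i : ℕ) = n - 1 then v (Fin.castAdd n i) else 0) - Y v (i + 1) := by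
  simp only [Matrix.mulVec, dotProduct, Fin.sum_univ_add, principalHamiltonianMatrix',
    Matrix.reindex_apply, Matrix.submatrix_apply, finSumFinEquiv_symm_apply_natAdd,
    finSumFinEquiv_symm_apply_castAdd, Matrix.fromBlocks_apply₂₁, Matrix.fromBlocks_apply₂₂,
    Matrix.neg_apply, Matrix.of_apply, Matrix.diagonal_apply, sub_eq_add_neg]
  congr 1
  · simp
  · simp only [neg_mul, Finset.sum_neg_distrib, ite_mul, one_mul, zero_mul]
    congr 1
    unfold Y
    split_ifs with h
    · rw [Finset.sum_eq_single (⟨i + 1, h⟩ : Fin n)]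
      · simp
      · intro b _ hb
        rw [if_neg]
        intro h'
        exact hb (Fin.ext h'.symm)
      · simp
    · apply Finset.sum_eq_zero
      intro b _
      rw [if_neg]
      have := b.2
      omega

lemma H_cast (a : Fin n → ℝ) (v : Fin (n + n) → ℝ) (i : Fin n) :
    (principalHamiltonianMatrix' n a *ᵥ v) (Fin.castAdd n i) =
      Z v (n - 1 - i + 1) + (-1) ^ (i : ℕ) * a i * v (Fin.natAdd n i) := by
  simp only [Matrix.mulVec, dotProduct, Fin.sum_univ_add, principalHamiltonianMatrix',
    Matrix.reindex_apply, Matrix.submatrix_apply, finSumFinEquiv_symm_apply_natAdd,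
    finSumFinEquiv_symm_apply_castAdd, Matrix.fromBlocks_apply₁₁, Matrix.fromBlocks_apply₁₂,
    Matrix.transpose_apply, Matrix.of_apply, Matrix.diagonal_apply]
  congr 1
  · simp only [ite_mul, one_mul, zero_mul]
    have hi := i.2
    unfold Z
    split_ifs with h
    · rw [Finset.sum_eq_single (⟨n - 1 - (n - 1 - i + 1), by omega⟩ : Fin n)]
      · rw [if_pos]
        simp only
        omega
      · intro b _ hb
        rw [if_neg]
        intro h'
        apply hb
        apply Fin.ext
        simp only
        omega
      · simp
    · apply Finset.sum_eq_zero
      intro b _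
      rw [if_neg]
      have := b.2
      omega
  · simp

lemma r_succ (a : Fin n → ℝ) (k : ℕ) (v : Fin (n + n) → ℝ) :
    r a (k + 1) v = r a k (principalHamiltonianMatrix' n a *ᵥ v) := by
  simp [r, pow_succ, Matrix.mulVec_mulVec]

lemma r_add (a : Fin n → ℝ) (k m : ℕ) (v : Fin (n + n) → ℝ) :
    r a (k + m) v = r a k (principalHamiltonianMatrix' n a ^ m *ᵥ v) := by
  simp [r, pow_add, Matrix.mulVec_mulVec]

lemma r_lt (a : Fin n → ℝ) (k : ℕ) (hk : k < n) (v : Fin (n + n) → ℝ) :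
    r a k v = (-1) ^ k * Y v k := by
  induction k generalizing v with
  | zero => simp [r]
  | succ k ih =>
    rw [r_succ, ih (by omega)]
    have : Y (principalHamiltonianMatrix' n a *ᵥ v) k = - Y v (k + 1) := by
      conv_lhs => unfold Y
      rw [dif_pos (by omega), H_nat, if_neg (by simp only; omega)]
      simp
    rw [this, pow_succ]
    ring

lemma r_n (hn : 1 ≤ n) (a : Fin n → ℝ) (v : Fin (n + n) → ℝ) :
    r a n v = (-1) ^ (n - 1) * Z v 0 := by
  obtain ⟨k, rfl⟩ : ∃ k, n = k + 1 := ⟨n - 1, by omega⟩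
  rw [r_succ, r_lt _ _ (by omega)]
  congr 1
  conv_lhs => unfold Y
  rw [dif_pos (by omega), H_nat, if_pos (by simp)]
  simp [Y, Z]

lemma Z_step (a : Fin n → ℝ) (v : Fin (n + n) → ℝ) (j : ℕ) (hj : j < n) :
    Z (principalHamiltonianMatrix' n a *ᵥ v) j =
      Z v (j + 1) + A a (n - 1 - j) * r a (n - 1 - j) v := by
  conv_lhs => unfold Z
  rw [dif_pos hj, H_cast, r_lt _ _ (by omega)]
  have h1 : n - 1 - (n - 1 - j) + 1 = j + 1 := by omega
  have h2 : n - 1 - j < n := by omega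
  simp only [h1, A, Y, dif_pos h2]
  ring

lemma Z_iter (a : Fin n → ℝ) (m : ℕ) (hm : m ≤ n) (v : Fin (n + n) → ℝ) :
    Z (principalHamiltonianMatrix' n a ^ m *ᵥ v) 0 =
      Z v m + ∑ j ∈ Finset.range m,
        A a (n - 1 - j) * r a ((n - 1 - j) + (m - 1 - j)) v := by
  induction m generalizing v with
  | zero => simp
  | succ m ih =>
    rw [pow_succ, ← Matrix.mulVec_mulVec, ih (by omega), Z_step _ _ _ (by omega),
      Finset.sum_range_succ]
    have : ∑ j ∈ Finset.range m, A a (n - 1 - j) *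
        r a ((n - 1 - j) + (m - 1 - j)) (principalHamiltonianMatrix' n a *ᵥ v) =
        ∑ j ∈ Finset.range m, A a (n - 1 - j) * r a ((n - 1 - j) + (m + 1 - 1 - j)) v := by
      apply Finset.sum_congr rfl
      intro j hj
      rw [Finset.mem_range] at hj
      rw [← r_succ]
      congr 2
      omega
    rw [this]
    have h : n - 1 - m + (m + 1 - 1 - m) = n - 1 - m := by omega
    rw [h]
    ring

lemma r_top (hn : 1 ≤ n) (a : Fin n → ℝ) (v : Fin (n + n) → ℝ) :
    r a (n + n) v = ∑ k : Fin n, (-1) ^ (n - 1) * a k * r a (2 * k) v := by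
  rw [r_add, r_n hn, Z_iter _ _ le_rfl]
  have h0 : Z v n = 0 := by simp [Z]
  rw [h0, zero_add,
    Finset.sum_range_reflect (fun i => A a i * r a (i + i) v) n,
    Finset.sum_range, Finset.mul_sum]
  apply Finset.sum_congr rfl
  intro k _
  simp [A, two_mul, mul_assoc]

/-- Observability matrix. -/
noncomputable def S (hn : 1 ≤ n) (a : Fin n → ℝ) : Matrix (Fin (n + n)) (Fin (n + n)) ℝ :=
  Matrix.of fun i j => (principalHamiltonianMatrix' n a ^ (i : ℕ)) (Fin.natAdd n ⟨0, hn⟩) j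

lemma S_mulVec (hn : 1 ≤ n) (a : Fin n → ℝ) (v : Fin (n + n) → ℝ) (i : Fin (n + n)) :
    (S hn a *ᵥ v) i = r a i v := by
  have : 0 < n := hn
  simp [S, r, Y, Matrix.mulVec, dotProduct, this]

lemma S_unit (hn : 1 ≤ n) (a : Fin n → ℝ) : IsUnit (S hn a) := by
  rw [← Matrix.mulVec_injective_iff_isUnit]
  rw [← Matrix.coe_mulVecLin, ← LinearMap.ker_eq_bot, LinearMap.ker_eq_bot']
  intro v hv
  have hr : ∀ k, k < n + n → r a k v = 0 := by
    intro k hk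
    have := congrFun hv ⟨k, hk⟩
    rw [Matrix.mulVecLin_apply, S_mulVec] at this
    simpa using this
  funext i
  refine Fin.addCases (fun i => ?_) (fun i => ?_) i
  · have hi := i.2
    have h := hr (n + (n - 1 - i)) (by omega)
    rw [r_add, r_n hn, Z_iter _ _ (by omega), Finset.sum_eq_zero, add_zero] at h
    · have h2 : Z v (n - 1 - i) = 0 := by simpa using h
      unfold Z at h2
      rw [dif_pos (by omega)] at h2
      rw [Pi.zero_apply, ← h2]
      congr 2
      apply Fin.ext
      simp only
      omega
    · intro j hj
      rw [Finset.mem_range] at hj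
      rw [hr _ (by omega), mul_zero]
  · have h := hr i (by omega)
    rw [r_lt _ _ i.2] at h
    simpa [Y] using h

lemma S_intertwine (hn : 1 ≤ n) (a : Fin n → ℝ) :
    S hn a * principalHamiltonianMatrix' n a = principalCompanionMatrix n a * S hn a := by
  apply Matrix.ext_of_mulVec_single
  intro c
  generalize (Pi.single c (1:ℝ) : Fin (n + n) → ℝ) = v
  rw [← Matrix.mulVec_mulVec, ← Matrix.mulVec_mulVec]
  funext i
  rw [S_mulVec, ← r_succ]
  have hi := i.2
  simp only [Matrix.mulVec, dotProduct, principalCompanionMatrix, Matrix.of_apply]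
  change _ = ∑ j, _ * (S hn a *ᵥ v) j
  simp only [S_mulVec, add_mul, Finset.sum_add_distrib]
  by_cases h : (i : ℕ) = n + n - 1
  · have e : (i : ℕ) + 1 = n + n := by omega
    have hz : ∑ x : Fin (n + n), (if (x : ℕ) = n + n then (1:ℝ) else 0) * r a (x : ℕ) v = 0 := by
      apply Finset.sum_eq_zero
      intro j _
      rw [if_neg, zero_mul]
      have := j.2
      omega
    rw [e, r_top hn, hz, zero_add]
    · simp only [h, if_true, Finset.sum_mul]
      rw [Finset.sum_comm]
      apply Finset.sum_congr rfl
      intro k _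
      have hk := k.2
      rw [Finset.sum_eq_single (⟨2 * k, by omega⟩ : Fin (n + n))]
      · simp
      · intro b _ hb
        rw [if_neg, zero_mul]
        intro h'
        exact hb (Fin.ext h')
      · simp
  · rw [Finset.sum_eq_single (⟨i + 1, by omega⟩ : Fin (n + n))]
    · simp [h]
    · intro b _ hb
      rw [if_neg, zero_mul]
      intro h'
      exact hb (Fin.ext h')
    · simp

end PHam

/-- If a₀ ≠ 0 then the principal Hamiltonian matrix 𝓗_a is
similar over ℝ to the companion matrix 𝒞_a of its characteristic polynomial
χ_a. -/
theorem principal_hamiltonian_similar_companion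
    (n : ℕ) (hn : 1 ≤ n) (a : Fin n → ℝ) (ha : a ⟨0, hn⟩ ≠ 0) :
    ∃ T : Matrix (Fin (n + n)) (Fin (n + n)) ℝ, IsUnit T ∧
      T⁻¹ * principalHamiltonianMatrix' n a * T = principalCompanionMatrix n a := by
  have hu := PHam.S_unit hn a
  have hd : IsUnit (PHam.S hn a).det := (Matrix.isUnit_iff_isUnit_det _).1 hu
  refine ⟨(PHam.S hn a)⁻¹, (Matrix.isUnit_nonsing_inv_iff).2 hu, ?_⟩
  rw [Matrix.nonsing_inv_nonsing_inv _ hd, PHam.S_intertwine, Matrix.mul_assoc,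
    Matrix.mul_nonsing_inv _ hd, Matrix.mul_one]
end

section
/- Suppose a₀ ≠ 0. Then the principal Hamiltonian matrix 𝓗_a is cyclic (non-derogatory): for every complex eigenvalue s of 𝓗_a (i.e. every s ∈ ℂ with det(s·I_{2n} − 𝓗_a) = 0), the space of solutions x ∈ ℂ^{2n} of (s·I_{2n} − 𝓗_a)·x = 0 has complex dimension exactly 1. -/
open Polynomial Matrix

theorem ph_inj (n : ℕ) (hn : 1 ≤ n) (a : Fin n → ℝ) (s : ℂ) (x : Fin n ⊕ Fin n → ℂ)
    (hx : (s • (1 : Matrix (Fin n ⊕ Fin n) (Fin n ⊕ Fin n) ℂ) -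
        (principalHamiltonianMatrix n a).map (algebraMap ℝ ℂ)) *ᵥ x = 0)
    (h0 : x (Sum.inr ⟨0, hn⟩) = 0) : x = 0 := by
  have hl : ∀ k : Fin n, s * x (Sum.inl k) -
      ((∑ j : Fin n, if (j:ℕ) + 1 = (k:ℕ) then x (Sum.inl j) else 0) +
        ((-1)^(k:ℕ) * (a k : ℂ)) * x (Sum.inr k)) = 0 := by
    intro k
    have h := congrFun hx (Sum.inl k)
    simp [principalHamiltonianMatrix, Matrix.sub_mulVec, Matrix.smul_mulVec, Matrix.mulVec,
      dotProduct, Matrix.diagonal_apply, apply_ite Complex.ofReal, ite_mul, Matrix.one_apply, sub_mul,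
      Finset.sum_sub_distrib] at h
    linear_combination h
  have hr : ∀ k : Fin n, s * x (Sum.inr k) -
      ((if (k:ℕ) = n - 1 then x (Sum.inl k) else 0) -
        ∑ j : Fin n, if (k:ℕ) + 1 = (j:ℕ) then x (Sum.inr j) else 0) = 0 := by
    intro k
    have h := congrFun hx (Sum.inr k)
    simp [principalHamiltonianMatrix, Matrix.sub_mulVec, Matrix.smul_mulVec, Matrix.mulVec,
      dotProduct, Matrix.diagonal_apply, apply_ite Complex.ofReal, ite_mul, Matrix.one_apply,
      add_mul, Finset.sum_add_distrib] at h
    linear_combination h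
  have hv : ∀ k : ℕ, ∀ hk : k < n, x (Sum.inr ⟨k, hk⟩) = 0 := by
    intro k
    induction k with
    | zero => intro _; exact h0
    | succ k ih =>
      intro hk
      have h := hr ⟨k, by omega⟩
      rw [ih, Finset.sum_eq_single (⟨k+1, hk⟩ : Fin n)] at h
      · simpa [show k ≠ n - 1 by omega] using h
      · intro j _ hj
        rw [if_neg]
        intro h'
        exact hj (Fin.ext h'.symm)
      · simp
  have hu : ∀ d : ℕ, ∀ k : ℕ, ∀ hk : k < n, k + d + 1 = n → x (Sum.inl ⟨k, hk⟩) = 0 := by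
    intro d
    induction d with
    | zero =>
      intro k hk hd
      have h := hr ⟨k, hk⟩
      rw [hv, Finset.sum_eq_zero] at h
      · simpa [show k = n - 1 by omega] using h
      · intro j _
        rw [if_neg]
        have := j.2
        simp only
        omega
    | succ d ih =>
      intro k hk hd
      have h := hl ⟨k+1, by omega⟩
      rw [hv, ih (k+1) _ (by omega), Finset.sum_eq_single (⟨k, hk⟩ : Fin n)] at h
      · simpa using h
      · intro j _ hj
        rw [if_neg]
        intro h'
        exact hj (Fin.ext (by simpa using h'))
      · simp
  funext i
  rcases i with k | k
  · exact hu (n - 1 - k) k k.2 (by omega)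
  · exact hv k k.2

/-- If a₀ ≠ 0 then 𝓗_a is cyclic (non-derogatory): for every
complex eigenvalue s of 𝓗_a, the solution space of (s·I − 𝓗_a)·x = 0 has
complex dimension exactly 1. -/
theorem principal_hamiltonian_cyclic
    (n : ℕ) (hn : 1 ≤ n) (a : Fin n → ℝ) (ha : a ⟨0, hn⟩ ≠ 0) :
    ∀ s : ℂ,
      (s • (1 : Matrix (Fin n ⊕ Fin n) (Fin n ⊕ Fin n) ℂ) -
        (principalHamiltonianMatrix n a).map (algebraMap ℝ ℂ)).det = 0 →
      Module.finrank ℂ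
        (LinearMap.ker
          ((s • (1 : Matrix (Fin n ⊕ Fin n) (Fin n ⊕ Fin n) ℂ) -
            (principalHamiltonianMatrix n a).map (algebraMap ℝ ℂ)).mulVecLin)) = 1 := by
  intro s hdet
  obtain ⟨w, hw, hMw⟩ := Matrix.exists_mulVec_eq_zero_iff.mpr hdet
  apply le_antisymm
  · have := LinearMap.finrank_le_finrank_of_injective
      (f := (LinearMap.proj (R := ℂ) (φ := fun _ : Fin n ⊕ Fin n => ℂ)
        (Sum.inr ⟨0, hn⟩)).comp (Submodule.subtype (LinearMap.ker
          ((s • (1 : Matrix (Fin n ⊕ Fin n) (Fin n ⊕ Fin n) ℂ) -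
            (principalHamiltonianMatrix n a).map (algebraMap ℝ ℂ)).mulVecLin)))) (by
        rw [← LinearMap.ker_eq_bot, LinearMap.ker_eq_bot']
        rintro ⟨x, hx⟩ h
        exact Subtype.ext (ph_inj n hn a s x hx h))
    simpa using this
  · rw [Nat.succ_le_iff, Module.finrank_pos_iff_exists_ne_zero]
    exact ⟨⟨w, hMw⟩, fun h => hw (congrArg Subtype.val h)⟩
end

section
/- For every s₀ ∈ ℂ, the complex dimension of the solution space of (s₀·𝖡 − 𝖠)·𝗑 = 0 in ℂ^{mν} equals the complex dimension of the solution space of A(s₀)·x = 0 in ℂ^m; i.e. the geometric multiplicities of s₀ for the linearized pencil s𝖡 − 𝖠 and for the matrix polynomial A(s) coincide. -/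
open Polynomial Matrix

/-- The block matrix 𝖡 of the linearization: block-diagonal with blocks
I_m, …, I_m, A_ν. -/
noncomputable def pencilB (m ν : ℕ) (A : Fin (ν+1) → Matrix (Fin m) (Fin m) ℂ) :
    Matrix (Fin ν × Fin m) (Fin ν × Fin m) ℂ :=
  Matrix.of fun p q =>
    if p.1 = q.1 then
      (if (p.1 : ℕ) = ν - 1 then A (Fin.last ν) p.2 q.2
       else if p.2 = q.2 then 1 else 0)
    else 0

/-- The block companion matrix 𝖠 of the linearization: identity blocks on the
superdiagonal and last block row (−A₀, …, −A_{ν−1}). -/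
noncomputable def pencilA (m ν : ℕ) (A : Fin (ν+1) → Matrix (Fin m) (Fin m) ℂ) :
    Matrix (Fin ν × Fin m) (Fin ν × Fin m) ℂ :=
  Matrix.of fun p q =>
    (if (q.1:ℕ) = (p.1:ℕ) + 1 ∧ p.2 = q.2 then 1 else 0) +
    (if (p.1:ℕ) = ν - 1 then -(A q.1.castSucc p.2 q.2) else 0)


lemma pencil_row_lt (m k : ℕ) (A : Fin (k+1+1) → Matrix (Fin m) (Fin m) ℂ) (s : ℂ)
    (x : Fin (k+1) × Fin m → ℂ) (i : Fin k) (a : Fin m) :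
    ((s • pencilB m (k+1) A - pencilA m (k+1) A) *ᵥ x) (i.castSucc, a) =
      s * x (i.castSucc, a) - x (i.succ, a) := by
  have hi : (i : ℕ) ≠ k := i.2.ne
  have h1 : (pencilB m (k+1) A *ᵥ x) (i.castSucc, a) = x (i.castSucc, a) := by
    simp only [Matrix.mulVec, dotProduct, pencilB, Matrix.of_apply]
    rw [Finset.sum_eq_single (i.castSucc, a)]
    · simp [hi]
    · rintro ⟨j, b⟩ - h
      by_cases hj : i.castSucc = j
      · have hb : a ≠ b := by rintro rfl; exact h (by rw [hj])
        simp [hi, hb]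
      · simp [hj]
    · simp
  have h2 : (pencilA m (k+1) A *ᵥ x) (i.castSucc, a) = x (i.succ, a) := by
    simp only [Matrix.mulVec, dotProduct, pencilA, Matrix.of_apply]
    rw [Finset.sum_eq_single (i.succ, a)]
    · simp [hi]
    · rintro ⟨j, b⟩ - h
      have : ¬ ((j : ℕ) = (i : ℕ) + 1 ∧ a = b) := by
        rintro ⟨h3, rfl⟩
        exact h (by rw [show j = i.succ from Fin.ext (by simpa using h3)])
      simp [hi, this]
    · simp
  rw [Matrix.sub_mulVec, Matrix.smul_mulVec]
  simp [h1, h2]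

lemma pencil_row_last (m k : ℕ) (A : Fin (k+1+1) → Matrix (Fin m) (Fin m) ℂ) (s : ℂ)
    (x : Fin (k+1) × Fin m → ℂ) (a : Fin m) :
    ((s • pencilB m (k+1) A - pencilA m (k+1) A) *ᵥ x) (Fin.last k, a) =
      s * ∑ b, A (Fin.last (k+1)) a b * x (Fin.last k, b) +
        ∑ j : Fin (k+1), ∑ b, A j.castSucc a b * x (j, b) := by
  have h1 : (pencilB m (k+1) A *ᵥ x) (Fin.last k, a) =
      ∑ b, A (Fin.last (k+1)) a b * x (Fin.last k, b) := by
    simp only [Matrix.mulVec, dotProduct, pencilB, Matrix.of_apply]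
    rw [Fintype.sum_prod_type, Finset.sum_eq_single (Fin.last k)]
    · simp
    · intro j _ h
      simp [h.symm]
    · simp
  have h2 : (pencilA m (k+1) A *ᵥ x) (Fin.last k, a) =
      - ∑ j : Fin (k+1), ∑ b, A j.castSucc a b * x (j, b) := by
    simp only [Matrix.mulVec, dotProduct, pencilA, Matrix.of_apply]
    rw [Fintype.sum_prod_type, ← Finset.sum_neg_distrib]
    refine Finset.sum_congr rfl fun j _ => ?_
    rw [← Finset.sum_neg_distrib]
    refine Finset.sum_congr rfl fun b _ => ?_
    have : (j : ℕ) ≠ k + 1 := j.2.ne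
    simp [this]
  rw [Matrix.sub_mulVec, Matrix.smul_mulVec]
  simp [h1, h2]

lemma pencil_poly_row (m k : ℕ) (A : Fin (k+1+1) → Matrix (Fin m) (Fin m) ℂ) (s : ℂ)
    (v : Fin m → ℂ) (x : Fin (k+1) × Fin m → ℂ)
    (hx : ∀ i a, x (i, a) = s ^ (i : ℕ) * v a) (a : Fin m) :
    ((s • pencilB m (k+1) A - pencilA m (k+1) A) *ᵥ x) (Fin.last k, a) =
      ((∑ j : Fin (k+1+1), s^(j:ℕ) • A j) *ᵥ v) a := by
  rw [pencil_row_last, Matrix.sum_mulVec, Finset.sum_apply, Fin.sum_univ_castSucc (n := k+1), add_comm (s * _)]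
  refine congrArg₂ (fun y z : ℂ => y + z) ?_ ?_
  · refine Finset.sum_congr rfl fun j _ => ?_
    simp only [Matrix.smul_apply, Matrix.mulVec, dotProduct, smul_eq_mul,
      Finset.mul_sum, hx, Fin.val_castSucc]
    exact Finset.sum_congr rfl fun b _ => by ring
  · simp only [Matrix.smul_apply, Matrix.mulVec, dotProduct, smul_eq_mul,
      Finset.mul_sum, hx, Fin.val_last]
    exact Finset.sum_congr rfl fun b _ => by ring

lemma pencil_ker_pow (m k : ℕ) (A : Fin (k+1+1) → Matrix (Fin m) (Fin m) ℂ) (s : ℂ)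
    (x : Fin (k+1) × Fin m → ℂ)
    (hx : (s • pencilB m (k+1) A - pencilA m (k+1) A) *ᵥ x = 0) (i : Fin (k+1)) (a : Fin m) :
    x (i, a) = s ^ (i : ℕ) * x (0, a) := by
  induction i using Fin.induction with
  | zero => simp
  | succ i ih =>
    have h := congrFun hx (i.castSucc, a)
    rw [pencil_row_lt, Pi.zero_apply, sub_eq_zero, ih] at h
    rw [← h, Fin.val_succ, Fin.val_castSucc, pow_succ]
    ring

theorem pencil_geometric_multiplicity_eq
    (m ν : ℕ) (hm : 0 < m) (hν : 0 < ν)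
    (A : Fin (ν+1) → Matrix (Fin m) (Fin m) ℂ) (s₀ : ℂ) :
    Module.finrank ℂ
        (LinearMap.ker ((s₀ • pencilB m ν A - pencilA m ν A).mulVecLin)) =
    Module.finrank ℂ
        (LinearMap.ker ((∑ j : Fin (ν+1), s₀^(j:ℕ) • A j).mulVecLin)) := by
  obtain ⟨k, rfl⟩ : ∃ k, ν = k + 1 := ⟨ν - 1, by omega⟩
  refine LinearEquiv.finrank_eq
    { toFun := fun x => ⟨fun a => x.1 (0, a), ?_⟩
      invFun := fun v => ⟨fun p => s₀ ^ (p.1 : ℕ) * v.1 p.2, ?_⟩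
      map_add' := fun x y => rfl
      map_smul' := fun c x => rfl
      left_inv := ?_
      right_inv := ?_ }
  · have hx : (s₀ • pencilB m (k+1) A - pencilA m (k+1) A) *ᵥ x.1 = 0 := x.2
    rw [LinearMap.mem_ker, Matrix.mulVecLin_apply]
    funext a
    rw [← pencil_poly_row m k A s₀ _ x.1 (pencil_ker_pow m k A s₀ x.1 hx) a, hx]
    rfl
  · have hv : (∑ j : Fin (k+1+1), s₀^(j:ℕ) • A j) *ᵥ v.1 = 0 := v.2
    rw [LinearMap.mem_ker, Matrix.mulVecLin_apply]
    funext ⟨i, a⟩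
    induction i using Fin.lastCases with
    | last =>
      rw [pencil_poly_row m k A s₀ v.1 _ (fun _ _ => rfl) a, hv]
      rfl
    | cast i =>
      rw [pencil_row_lt]
      simp only [Fin.val_succ, Fin.val_castSucc, Pi.zero_apply]
      ring
  · intro x
    apply Subtype.ext
    funext ⟨i, a⟩
    exact (pencil_ker_pow m k A s₀ x.1 x.2 i a).symm
  · intro v
    apply Subtype.ext
    funext a
    simp
end

section
/- Suppose A_ν is invertible, and set 𝖠' = 𝖡⁻¹·𝖠. Let s₀ ∈ ℂ be such that the solution space of A(s₀)·x = 0 in ℂ^m has dimension exactly 1, and let m₀ ≥ 2 be the multiplicity of s₀ as a root of the polynomial s ↦ det A(s). Then the Jordan structure of 𝖠' at s₀ consists of exactly one Jordan block of size m₀; equivalently, for every natural number k, the complex dimension of the kernel of (𝖠' − s₀·I_{mν})^k equals min(k, m₀). -/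
open Polynomial Matrix

/-- The determinant det A(s) as a polynomial in s. -/
noncomputable def matPolyDet (m ν : ℕ) (A : Fin (ν+1) → Matrix (Fin m) (Fin m) ℂ) :
    Polynomial ℂ :=
  (∑ j : Fin (ν+1), (Polynomial.X : ℂ[X])^(j:ℕ) • (A j).map Polynomial.C).det

/-- determinant of a block upper triangular matrix -/
theorem det_comp_upper {R : Type*} [CommRing R] {n m : ℕ}
    (T : Matrix (Fin n) (Fin n) (Matrix (Fin m) (Fin m) R))
    (h : ∀ i j, j < i → T i j = 0) :
    (Matrix.comp _ _ _ _ R T).det = ∏ i, (T i i).det := by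
  have hb : (Matrix.comp _ _ _ _ R T).BlockTriangular Prod.fst := by
    intro p q hpq
    simp [Matrix.comp_apply, h _ _ hpq]
  rw [hb.det_fintype]
  refine Finset.prod_congr rfl fun k _ => ?_
  let e : Fin m ≃ {p : Fin n × Fin m // p.1 = k} :=
    { toFun := fun a => ⟨(k, a), rfl⟩
      invFun := fun p => p.1.2
      left_inv := fun a => rfl
      right_inv := by rintro ⟨⟨a, b⟩, rfl⟩; rfl }
  rw [← Matrix.det_submatrix_equiv_self e]
  rfl

theorem det_comp_lower {R : Type*} [CommRing R] {n m : ℕ}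
    (T : Matrix (Fin n) (Fin n) (Matrix (Fin m) (Fin m) R))
    (h : ∀ i j, i < j → T i j = 0) :
    (Matrix.comp _ _ _ _ R T).det = ∏ i, (T i i).det := by
  rw [← Matrix.det_transpose, Matrix.transpose_comp, det_comp_upper]
  · simp [Matrix.det_transpose]
  · intro i j hij
    simp [h _ _ hij]

/-- block pencil `x B - A` -/
def blkP {R S : Type*} [CommRing R] [Ring S] [Algebra R S] (n : ℕ) (a : Fin (n+2) → S) (x : R) :
    Matrix (Fin (n+1)) (Fin (n+1)) S :=
  Matrix.of fun i l => Fin.lastCases (motive := fun _ => S)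
    (a l.castSucc + if l = Fin.last n then x • a (Fin.last (n+1)) else 0)
    (fun i => (if l = i.castSucc then x • 1 else 0) - (if l = i.succ then 1 else 0)) i

def blkU {R : Type*} (S : Type*) [CommRing R] [Ring S] [Algebra R S] (n : ℕ) (x : R) :
    Matrix (Fin (n+1)) (Fin (n+1)) S :=
  Matrix.of fun i j => if j ≤ i then x ^ ((i:ℕ) - j) • 1 else 0

theorem blk_last {R S : Type*} [CommRing R] [Ring S] [Algebra R S] (n : ℕ)
    (a : Fin (n+2) → S) (x : R) :
    (blkP n a x * blkU S n x) (Fin.last n) 0 = ∑ j : Fin (n+2), x ^ (j:ℕ) • a j := by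
  rw [Matrix.mul_apply, Fin.sum_univ_castSucc (n := n+1)]
  simp [blkP, blkU, add_mul, Finset.sum_add_distrib, smul_smul, pow_succ]

theorem blk_castSucc {R S : Type*} [CommRing R] [Ring S] [Algebra R S] (n : ℕ)
    (a : Fin (n+2) → S) (x : R) (i : Fin n) (j : Fin (n+1)) :
    (blkP n a x * blkU S n x) i.castSucc j = if j = i.succ then -1 else 0 := by
  rw [Matrix.mul_apply]
  simp only [blkP, blkU, Matrix.of_apply, Fin.lastCases_castSucc, sub_mul, Finset.sum_sub_distrib,
    ite_mul, zero_mul, Finset.sum_ite_eq', Finset.sum_ite_eq, Finset.mem_univ, if_true, one_mul]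
  simp only [Fin.le_def, Fin.ext_iff, Fin.val_castSucc, Fin.val_succ]
  rcases lt_trichotomy (j:ℕ) ((i:ℕ)+1) with h | h | h
  · rw [if_pos (by omega), if_pos (by omega), if_neg (by omega)]
    rw [show (i:ℕ) + 1 - j = (i - j) + 1 by omega, pow_succ']
    simp [smul_smul, mul_comm]
  · rw [if_neg (by omega), if_pos (by omega), if_pos (by omega)]
    simp [h]
  · rw [if_neg (by omega), if_neg (by omega), if_neg (by omega)]
    simp

theorem finRotate_symm_succ (n : ℕ) (i : Fin n) :
    (finRotate (n+1)).symm i.succ = i.castSucc := by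
  rw [Equiv.symm_apply_eq, finRotate_apply]; simp

theorem finRotate_symm_z (n : ℕ) :
    (finRotate (n+1)).symm 0 = Fin.last n := by
  rw [Equiv.symm_apply_eq, finRotate_apply]; simp

theorem det_blkP {R : Type*} [CommRing R] {m : ℕ} (n : ℕ)
    (a : Fin (n+2) → Matrix (Fin m) (Fin m) R) (x : R) :
    ∃ u : R, IsUnit u ∧ (Matrix.comp _ _ _ _ R (blkP n a x)).det =
      u * (∑ j : Fin (n+2), x ^ (j:ℕ) • a j).det := by
  have hU : (Matrix.comp _ _ _ _ R (blkU (Matrix (Fin m) (Fin m) R) n x)).det = 1 := by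
    rw [det_comp_lower]
    · simp [blkU]
    · intro i j hij
      simp [blkU, not_le.2 hij]
  set Q := blkP n a x * blkU (Matrix (Fin m) (Fin m) R) n x with hQ
  have h1 : (Matrix.comp _ _ _ _ R Q).det = (Matrix.comp _ _ _ _ R (blkP n a x)).det := by
    have := map_mul (Matrix.compRingEquiv (Fin (n+1)) (Fin m) R) (blkP n a x)
      (blkU (Matrix (Fin m) (Fin m) R) n x)
    simp only [Matrix.compRingEquiv_apply] at this
    rw [hQ, this, Matrix.det_mul, hU, mul_one]
  let σ : Equiv.Perm (Fin (n+1)) := (finRotate (n+1)).symm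
  let τ : Equiv.Perm (Fin (n+1) × Fin m) := Equiv.prodCongr σ (Equiv.refl _)
  have h2 : (Matrix.comp _ _ _ _ R (Q.submatrix σ id)).det =
      Equiv.Perm.sign τ * (Matrix.comp _ _ _ _ R Q).det := by
    rw [← Matrix.det_permute]; rfl
  have h3 : (Matrix.comp _ _ _ _ R (Q.submatrix σ id)).det =
      (∑ j : Fin (n+2), x ^ (j:ℕ) • a j).det * ((-1) ^ m) ^ n := by
    rw [det_comp_upper]
    · rw [Fin.prod_univ_succ]
      simp only [Matrix.submatrix_apply, id, σ, finRotate_symm_succ, finRotate_symm_z]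
      rw [hQ, blk_last]
      simp [blk_castSucc, Matrix.det_neg]
    · intro i j hij
      induction i using Fin.cases with
      | zero => simp at hij
      | succ i =>
        simp only [Matrix.submatrix_apply, id, σ, finRotate_symm_succ]
        rw [hQ, blk_castSucc, if_neg hij.ne]
  have hs : IsUnit ((Equiv.Perm.sign τ : ℤ) : R) := by
    exact ((Equiv.Perm.sign τ).isUnit).map (Int.castRingHom R)
  obtain ⟨s, hs'⟩ := hs
  refine ⟨↑s⁻¹ * ((-1) ^ m) ^ n, ?_, ?_⟩
  · exact (Units.isUnit _).mul ((isUnit_one.neg.pow _).pow _)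
  · rw [← h1]
    have := h2.symm.trans h3
    rw [← hs'] at this
    rw [mul_assoc, mul_comm (_ ^ n), ← this, Units.inv_mul_cancel_left]

theorem pencil_eq (m n : ℕ) (A : Fin (n+2) → Matrix (Fin m) (Fin m) ℂ)
    {R : Type*} [CommRing R] (f : ℂ →+* R) (x : R) :
    x • (pencilB m (n+1) A).map f - (pencilA m (n+1) A).map f =
      Matrix.comp _ _ _ _ R (blkP n (fun j => (A j).map f) x) := by
  ext ⟨i, k⟩ ⟨j, l⟩
  induction i using Fin.lastCases with
  | last =>
    by_cases hj : j = Fin.last n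
    · subst hj
      simp [blkP, pencilA, pencilB, Matrix.comp_apply]
      ring
    · have : (j : ℕ) ≠ n + 1 := by omega
      simp [blkP, pencilA, pencilB, Matrix.comp_apply, hj, Ne.symm hj, this]
  | cast i =>
    have hi : (i : ℕ) ≠ n := by omega
    simp only [blkP, pencilA, pencilB, Matrix.comp_apply, Fin.ext_iff, Matrix.sub_apply,
      Matrix.smul_apply, Matrix.map_apply, Matrix.of_apply, Fin.val_castSucc, Fin.val_succ,
      add_tsub_cancel_right, hi, if_false, Equiv.coe_fn_mk, Fin.lastCases_castSucc]
    by_cases h1 : (j:ℕ) = i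
    · simp [h1, Matrix.one_apply, Fin.ext_iff, apply_ite f]
    · by_cases h2 : (j:ℕ) = i + 1
      · simp [h2, Matrix.one_apply, Fin.ext_iff, apply_ite f]
      · simp [h1, h2, Ne.symm h1]

theorem isUnit_pencilB (m n : ℕ) (A : Fin (n+2) → Matrix (Fin m) (Fin m) ℂ)
    (h : IsUnit (A (Fin.last (n+1)))) : IsUnit (pencilB m (n+1) A) := by
  have : pencilB m (n+1) A = Matrix.comp _ _ _ _ ℂ
      (Matrix.diagonal fun i : Fin (n+1) => if i = Fin.last n then A (Fin.last (n+1)) else 1) := by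
    ext ⟨i, k⟩ ⟨j, l⟩
    by_cases hij : i = j
    · subst hij
      by_cases hi : i = Fin.last n
      · subst hi; simp [pencilB, Matrix.comp_apply]
      · have : (i:ℕ) ≠ n := fun h => hi (Fin.ext h)
        simp [pencilB, Matrix.comp_apply, hi, this, Matrix.one_apply]
    · simp [pencilB, Matrix.comp_apply, hij]
  rw [Matrix.isUnit_iff_isUnit_det, this, det_comp_upper]
  · simp only [Matrix.diagonal_apply_eq]
    refine isUnit_iff_ne_zero.2 (Finset.prod_ne_zero_iff.2 fun i _ => ?_)
    split_ifs
    · exact ((Matrix.isUnit_iff_isUnit_det _).1 h).ne_zero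
    · simp
  · intro i j hij
    simp [hij.ne']

theorem rootMult_eq (m n : ℕ) (A : Fin (n+2) → Matrix (Fin m) (Fin m) ℂ)
    (h : IsUnit (A (Fin.last (n+1)))) (s : ℂ) :
    ((pencilB m (n+1) A)⁻¹ * pencilA m (n+1) A).charpoly.rootMultiplicity s =
      (matPolyDet m (n+1) A).rootMultiplicity s := by
  set B := pencilB m (n+1) A with hB
  have hBu : IsUnit B := isUnit_pencilB m n A h
  have hBd : IsUnit B.det := (Matrix.isUnit_iff_isUnit_det _).1 hBu
  set M := B⁻¹ * pencilA m (n+1) A with hM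
  have hBM : B * M = pencilA m (n+1) A := by
    rw [hM, Matrix.mul_nonsing_inv_cancel_left _ _ hBd]
  have e1 : B.map C * M.charmatrix =
      (X : ℂ[X]) • B.map (C : ℂ →+* ℂ[X]) - (pencilA m (n+1) A).map (C : ℂ →+* ℂ[X]) := by
    rw [← hBM, Matrix.charmatrix, mul_sub, Matrix.map_mul, RingHom.mapMatrix_apply,
      Matrix.scalar_apply, ← Matrix.smul_one_eq_diagonal, mul_smul_comm, mul_one]
  have e2 : (B.map C).det * M.charpoly =
      (Matrix.comp _ _ _ _ _ (blkP n (fun j => (A j).map (C : ℂ →+* ℂ[X])) (X : ℂ[X]))).det := by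
    rw [Matrix.charpoly, ← Matrix.det_mul, e1, hB, pencil_eq]
  obtain ⟨u, hu, e3⟩ := det_blkP n (fun j => (A j).map (C : ℂ →+* ℂ[X])) X
  have e4 : (B.map C).det = C B.det := by
    exact (RingHom.map_det C B).symm
  have hu' : IsUnit (C B.det) := hBd.map C
  have e5 : C B.det * M.charpoly = u * matPolyDet m (n+1) A := by
    rw [← e4, e2, e3]; rfl
  have hc : M.charpoly ≠ 0 := (Matrix.charpoly_monic M).ne_zero
  have d1 : M.charpoly ∣ matPolyDet m (n+1) A := by
    rw [← hu.dvd_mul_left, ← e5]; exact dvd_mul_left _ _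
  have d2 : matPolyDet m (n+1) A ∣ M.charpoly := by
    rw [← hu'.dvd_mul_left, e5]; exact dvd_mul_left _ _
  apply le_antisymm
  · refine rootMultiplicity_le_rootMultiplicity_of_dvd ?_ d1 s
    intro h0
    rw [h0, zero_dvd_iff] at d2
    exact hc d2
  · exact rootMultiplicity_le_rootMultiplicity_of_dvd hc d2 s

theorem ker_le_one (m n : ℕ) (A : Fin (n+2) → Matrix (Fin m) (Fin m) ℂ)
    (h : IsUnit (A (Fin.last (n+1)))) (s : ℂ) :
    Module.finrank ℂ (LinearMap.ker (((pencilB m (n+1) A)⁻¹ * pencilA m (n+1) A -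
      s • (1 : Matrix (Fin (n+1) × Fin m) (Fin (n+1) × Fin m) ℂ)).mulVecLin)) ≤
    Module.finrank ℂ (LinearMap.ker ((∑ j : Fin (n+2), s^(j:ℕ) • A j).mulVecLin)) := by
  set B := pencilB m (n+1) A with hB
  have hBu : IsUnit B := isUnit_pencilB m n A h
  have hBd : IsUnit B.det := (Matrix.isUnit_iff_isUnit_det _).1 hBu
  have key : ∀ v : Fin (n+1) × Fin m → ℂ,
      (B⁻¹ * pencilA m (n+1) A - s • 1) *ᵥ v = 0 →
      (∀ i : Fin (n+1), ∀ k, v (i, k) = s ^ (i:ℕ) * v (0, k)) ∧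
      (∑ j : Fin (n+2), s^(j:ℕ) • A j) *ᵥ (fun k => v (0, k)) = 0 := by
    intro v hv
    have h1 : (Matrix.comp _ _ _ _ ℂ (blkP n A s)) *ᵥ v = 0 := by
      have e := pencil_eq m n A (RingHom.id ℂ) s
      simp only [RingHom.coe_id, Matrix.map_id] at e
      rw [← e]
      have : s • pencilB m (n+1) A - pencilA m (n+1) A =
          -(B * (B⁻¹ * pencilA m (n+1) A - s • 1)) := by
        rw [mul_sub, Matrix.mul_nonsing_inv_cancel_left _ _ hBd]
        simp [hB]
      rw [this, Matrix.neg_mulVec, ← Matrix.mulVec_mulVec, hv]; simp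
    have h2 : ∀ i k, ∑ j, (blkP n A s i j *ᵥ (fun l => v (j, l))) k = 0 := by
      intro i k
      have := congrFun h1 (i, k)
      simpa [Matrix.mulVec, dotProduct, Fintype.sum_prod_type, Matrix.comp_apply] using this
    have h3 : ∀ (i : Fin n) k, v (i.succ, k) = s * v (i.castSucc, k) := by
      intro i k
      have := h2 i.castSucc k
      simp only [blkP, Matrix.of_apply, Fin.lastCases_castSucc, Matrix.sub_mulVec, Pi.sub_apply,
        Finset.sum_sub_distrib] at this
      rw [Finset.sum_eq_single i.castSucc (by intro b _ hb; simp [hb]) (by simp),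
        Finset.sum_eq_single i.succ (by intro b _ hb; simp [hb]) (by simp)] at this
      simp [Matrix.smul_mulVec] at this
      exact (sub_eq_zero.1 this).symm
    have h4 : ∀ i : Fin (n+1), ∀ k, v (i, k) = s ^ (i:ℕ) * v (0, k) := by
      intro i k
      induction i using Fin.induction with
      | zero => simp
      | succ i ih => rw [h3, ih]; simp [pow_succ']; ring
    refine ⟨h4, ?_⟩
    have h5 : ∀ j : Fin (n+1), (fun l => v (j, l)) = s ^ (j:ℕ) • fun l => v (0, l) := by
      intro j; ext l; simp [h4 j l]
    ext k
    have : ∑ j : Fin (n+1), (blkP n A s (Fin.last n) j *ᵥ (s ^ (j:ℕ) • fun l => v (0, l))) k = 0 := by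
      rw [← h2 (Fin.last n) k]
      exact Finset.sum_congr rfl fun j _ => by rw [h5 j]
    rw [Pi.zero_apply, ← this, Fin.sum_univ_castSucc (n := n+1)]
    simp only [blkP, Matrix.of_apply, Fin.lastCases_last, Matrix.add_mulVec, Pi.add_apply,
      Finset.sum_add_distrib]
    congr 1
    · simp [Matrix.sum_mulVec, Matrix.smul_mulVec, Matrix.mulVec_smul]
    · rw [Finset.sum_eq_single (Fin.last n) (by intro b _ hb; simp [hb]) (by simp)]
      simp [Matrix.smul_mulVec, Matrix.mulVec_smul, pow_succ]
      ring
  let π : (Fin (n+1) × Fin m → ℂ) →ₗ[ℂ] (Fin m → ℂ) := LinearMap.funLeft ℂ ℂ (fun k => (0, k))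
  let g := π.restrict (p := LinearMap.ker ((B⁻¹ * pencilA m (n+1) A - s • 1).mulVecLin))
    (q := LinearMap.ker ((∑ j : Fin (n+2), s^(j:ℕ) • A j).mulVecLin))
    (fun v hv => (key v hv).2)
  refine LinearMap.finrank_le_finrank_of_injective (f := g) ?_
  rw [← LinearMap.ker_eq_bot, LinearMap.ker_eq_bot']
  rintro ⟨v, hv⟩ h0
  have h0' : π v = 0 := congrArg Subtype.val h0
  ext ⟨i, k⟩
  have : v (0, k) = 0 := congrFun h0' k
  have h6 := (key v hv).1 i k
  rw [this, mul_zero] at h6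
  exact h6

theorem finrank_ker_pow_succ_le {V : Type*} [AddCommGroup V] [Module ℂ V]
    [FiniteDimensional ℂ V] (N : Module.End ℂ V) (k : ℕ) :
    Module.finrank ℂ (LinearMap.ker (N ^ (k+1))) ≤
      Module.finrank ℂ (LinearMap.ker (N ^ k)) + Module.finrank ℂ (LinearMap.ker N) := by
  let g := (N ^ k).restrict (p := LinearMap.ker (N ^ (k+1))) (q := LinearMap.ker N) (by
    intro v hv
    rw [LinearMap.mem_ker] at hv ⊢
    rwa [pow_succ'] at hv)
  have h1 := g.finrank_range_add_finrank_ker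
  have h2 := Submodule.finrank_le (LinearMap.range g)
  have h3 : Module.finrank ℂ (LinearMap.ker g) ≤ Module.finrank ℂ (LinearMap.ker (N ^ k)) := by
    let j : LinearMap.ker g →ₗ[ℂ] LinearMap.ker (N ^ k) :=
      ((Submodule.subtype _).comp (Submodule.subtype _)).codRestrict _ (by
        rintro ⟨v, hv⟩
        exact congrArg Subtype.val hv)
    refine LinearMap.finrank_le_finrank_of_injective (f := j) ?_
    intro a b hab
    have hab' : (a : LinearMap.ker (N ^ (k+1))).1 = (b : LinearMap.ker (N ^ (k+1))).1 :=
      congrArg (fun z : LinearMap.ker (N ^ k) => z.1) hab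
    exact Subtype.ext (Subtype.ext hab')
  omega

theorem finrank_ker_pow_eq {V : Type*} [AddCommGroup V] [Module ℂ V]
    [FiniteDimensional ℂ V] (f : Module.End ℂ V) (s : ℂ)
    (h1 : Module.finrank ℂ (LinearMap.ker (f - s • 1)) ≤ 1) (k : ℕ) :
    Module.finrank ℂ (LinearMap.ker ((f - s • 1) ^ k)) =
      min k (f.charpoly.rootMultiplicity s) := by
  set r := f.charpoly.rootMultiplicity s with hr
  have hle : ∀ k, Module.finrank ℂ (LinearMap.ker ((f - s • 1) ^ k)) ≤ r := by
    intro k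
    have := LinearMap.finrank_genEigenspace_le f s k
    rwa [Module.End.genEigenspace_nat] at this
  have htop : Module.finrank ℂ (LinearMap.ker ((f - s • 1) ^ Module.finrank ℂ V)) = r := by
    rw [hr, ← LinearMap.finrank_maxGenEigenspace_eq,
      Module.End.maxGenEigenspace_eq_genEigenspace_finrank, Module.End.genEigenspace_nat]
  induction k with
  | zero => simp [Module.End.one_eq_id]
  | succ k ih =>
    have a1 := finrank_ker_pow_succ_le (f - s • 1) k
    have a2 := hle (k+1)
    have hsub : LinearMap.ker ((f - s • 1) ^ k) ≤ LinearMap.ker ((f - s • 1) ^ (k+1)) := by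
      intro v hv
      rw [LinearMap.mem_ker] at hv ⊢
      rw [pow_succ', Module.End.mul_apply, hv, map_zero]
    have a3 := Submodule.finrank_mono hsub
    by_cases hEq : Module.finrank ℂ (LinearMap.ker ((f - s • 1) ^ k)) =
        Module.finrank ℂ (LinearMap.ker ((f - s • 1) ^ (k+1)))
    · have hk := Submodule.eq_of_le_of_finrank_eq hsub hEq
      have c1 := Module.End.ker_pow_constant hk (Module.finrank ℂ V)
      have c2 := Module.End.ker_pow_eq_ker_pow_finrank_of_le (f := f - s • 1)
        (m := k + Module.finrank ℂ V) (by omega)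
      rw [c1, c2, htop] at ih
      rw [← hEq, c1, c2, htop]
      omega
    · omega

/-- If A_ν is invertible, the kernel of A(s₀) is one-dimensional,
and s₀ is a root of det A(s) of multiplicity m₀ ≥ 2, then 𝖠' = 𝖡⁻¹𝖠 has at s₀
exactly one Jordan block, of size m₀: for every k,
dim ker (𝖠' − s₀ I)^k = min(k, m₀). -/
theorem single_jordan_block_of_cyclic_eigenvalue
    (m ν : ℕ) (hm : 0 < m) (hν : 0 < ν)
    (A : Fin (ν+1) → Matrix (Fin m) (Fin m) ℂ)
    (hAν : IsUnit (A (Fin.last ν)))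
    (s₀ : ℂ) (m₀ : ℕ)
    (hker :
      Module.finrank ℂ
        (LinearMap.ker ((∑ j : Fin (ν+1), s₀^(j:ℕ) • A j).mulVecLin)) = 1)
    (hm₀ : m₀ = Polynomial.rootMultiplicity s₀ (matPolyDet m ν A))
    (hm₀2 : 2 ≤ m₀) :
    ∀ k : ℕ,
      Module.finrank ℂ
        (LinearMap.ker
          ((((pencilB m ν A)⁻¹ * pencilA m ν A -
              s₀ • (1 : Matrix (Fin ν × Fin m) (Fin ν × Fin m) ℂ)) ^ k).mulVecLin)) =
      min k m₀ := by
  obtain ⟨n, rfl⟩ : ∃ n, ν = n + 1 := ⟨ν - 1, by omega⟩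
  intro k
  set M := (pencilB m (n+1) A)⁻¹ * pencilA m (n+1) A with hM
  have hk := ker_le_one m n A hAν s₀
  rw [hker] at hk
  have e : ∀ k, ((M - s₀ • (1 : Matrix (Fin (n+1) × Fin m) (Fin (n+1) × Fin m) ℂ)) ^ k).mulVecLin =
      (M.mulVecLin - s₀ • (1 : Module.End ℂ (Fin (n+1) × Fin m → ℂ))) ^ k := by
    intro k
    rw [← Matrix.toLin'_apply', ← Matrix.toLin'_apply', Matrix.toLin'_pow, map_sub, map_smul,
      Matrix.toLin'_one]
    rfl
  have e1 := e 1
  rw [pow_one, pow_one] at e1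
  rw [← hM, e1] at hk
  rw [e, finrank_ker_pow_eq _ _ hk, Matrix.charpoly_mulVecLin, hM, rootMult_eq m n A hAν, hm₀]
end

section
/- Let q₁, q₂ : ℝ → ℝ be four-times continuously differentiable functions satisfying, for all t ∈ ℝ, the Euler–Lagrange equations L₁·q₁''(t) − G₁·q₂'(t) + q₁(t)/C₁ = 0 and L₂·q₂''(t) + G₁·q₁'(t) + q₂(t)/C₂ = 0. Then each of q₁ and q₂ satisfies the scalar fourth-order differential equation q_k''''(t) + (G₁²/(L₁L₂) + 1/(L₁C₁) + 1/(L₂C₂))·q_k''(t) + q_k(t)/(L₁C₁L₂C₂) = 0 for all t ∈ ℝ and k = 1, 2. -/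
theorem hasDerivAt_iter_aux (f : ℝ → ℝ) (hf : ContDiff ℝ 4 f) (k : ℕ) (hk : k < 4) (t : ℝ) :
    HasDerivAt (iteratedDeriv k f) (iteratedDeriv (k+1) f t) t := by
  rw [iteratedDeriv_succ]
  exact ((hf.differentiable_iteratedDeriv k (by exact_mod_cast hk)) t).hasDerivAt

theorem el_step_aux (L g c : ℝ) (q p : ℝ → ℝ) (hq : ContDiff ℝ 4 q) (hp : ContDiff ℝ 4 p)
    (k : ℕ) (hk : k < 2)
    (h : ∀ t, L * iteratedDeriv (k+2) q t + g * iteratedDeriv (k+1) p t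
      + iteratedDeriv k q t / c = 0) (t : ℝ) :
    L * iteratedDeriv (k+1+2) q t + g * iteratedDeriv (k+1+1) p t
      + iteratedDeriv (k+1) q t / c = 0 := by
  have h1 := (((hasDerivAt_iter_aux q hq (k+2) (by omega) t).const_mul L).add
    ((hasDerivAt_iter_aux p hp (k+1) (by omega) t).const_mul g)).add
    ((hasDerivAt_iter_aux q hq k (by omega) t).div_const c)
  have h2 : HasDerivAt (fun _ : ℝ => (0:ℝ)) 0 t := hasDerivAt_const t 0
  have h3 : (fun _ : ℝ => (0:ℝ)) = fun t => L * iteratedDeriv (k+2) q t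
      + g * iteratedDeriv (k+1) p t + iteratedDeriv k q t / c := by
    funext s; exact (h s).symm
  rw [h3] at h2
  exact h1.unique h2

/-- If q₁, q₂ are C⁴ functions satisfying the Euler–Lagrange
equations L₁q₁'' − G₁q₂' + q₁/C₁ = 0 and L₂q₂'' + G₁q₁' + q₂/C₂ = 0, then each
of q₁, q₂ satisfies the scalar fourth-order equation
q'''' + (G₁²/(L₁L₂) + 1/(L₁C₁) + 1/(L₂C₂))·q'' + q/(L₁C₁L₂C₂) = 0. -/
theorem euler_lagrange_implies_scalar_fourth_order
    (L₁ C₁ L₂ C₂ G₁ : ℝ) (hL₁ : L₁ ≠ 0) (hC₁ : C₁ ≠ 0) (hL₂ : L₂ ≠ 0)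
    (hC₂ : C₂ ≠ 0) (hG₁ : G₁ ≠ 0)
    (q₁ q₂ : ℝ → ℝ)
    (hq₁ : ContDiff ℝ 4 q₁) (hq₂ : ContDiff ℝ 4 q₂)
    (hEL₁ : ∀ t : ℝ,
      L₁ * iteratedDeriv 2 q₁ t - G₁ * deriv q₂ t + q₁ t / C₁ = 0)
    (hEL₂ : ∀ t : ℝ,
      L₂ * iteratedDeriv 2 q₂ t + G₁ * deriv q₁ t + q₂ t / C₂ = 0) :
    ∀ t : ℝ,
      (iteratedDeriv 4 q₁ t +
        (G₁^2/(L₁*L₂) + 1/(L₁*C₁) + 1/(L₂*C₂)) * iteratedDeriv 2 q₁ t +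
        q₁ t / (L₁*C₁*L₂*C₂) = 0) ∧
      (iteratedDeriv 4 q₂ t +
        (G₁^2/(L₁*L₂) + 1/(L₁*C₁) + 1/(L₂*C₂)) * iteratedDeriv 2 q₂ t +
        q₂ t / (L₁*C₁*L₂*C₂) = 0) := by
  have a0 : ∀ t, L₁ * iteratedDeriv (0+2) q₁ t + (-G₁) * iteratedDeriv (0+1) q₂ t
      + iteratedDeriv 0 q₁ t / C₁ = 0 := by
    intro t
    have := hEL₁ t
    simp only [zero_add, iteratedDeriv_one, iteratedDeriv_zero]
    linarith
  have b0 : ∀ t, L₂ * iteratedDeriv (0+2) q₂ t + G₁ * iteratedDeriv (0+1) q₁ t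
      + iteratedDeriv 0 q₂ t / C₂ = 0 := by
    intro t
    have := hEL₂ t
    simp only [zero_add, iteratedDeriv_one, iteratedDeriv_zero]
    linarith
  have a1 := el_step_aux _ _ _ _ _ hq₁ hq₂ 0 (by norm_num) a0
  have b1 := el_step_aux _ _ _ _ _ hq₂ hq₁ 0 (by norm_num) b0
  have a2 := el_step_aux _ _ _ _ _ hq₁ hq₂ (0+1) (by norm_num) a1
  have b2 := el_step_aux _ _ _ _ _ hq₂ hq₁ (0+1) (by norm_num) b1
  intro t
  have e1 := hEL₁ t
  have e2 := hEL₂ t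
  replace a1 := a1 t
  replace b1 := b1 t
  replace a2 := a2 t
  replace b2 := b2 t
  norm_num only [iteratedDeriv_one] at a1 b1 a2 b2
  have hLL : L₁ * L₂ ≠ 0 := mul_ne_zero hL₁ hL₂
  constructor
  · apply mul_left_cancel₀ hLL
    rw [mul_zero]
    have := congrArg₂ (· + ·) (congrArg₂ (· + ·) (congrArg (L₂ * ·) a2) (congrArg (G₁ * ·) b1))
      (congrArg (· / C₂) e1)
    simp only [mul_zero, zero_div, add_zero] at this
    rw [← this]
    field_simp
    ring
  · apply mul_left_cancel₀ hLL
    rw [mul_zero]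
    have := congrArg₂ (· + ·) (congrArg₂ (· + ·) (congrArg (L₁ * ·) b2) (congrArg (-G₁ * ·) a1))
      (congrArg (· / C₁) e2)
    simp only [mul_zero, zero_div, add_zero] at this
    rw [← this]
    field_simp
    ring
end
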